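/- arXiv:1709.06735 — 6 statements merged into one kernel-verified Lean document; each statement's English description precedes it below -/
import Mathlib

section
/- For any integers a and b with a > 1, b > 1, and a + b > 9, the partition function satisfies p(a) · p(b) > p(a + b). -/
open Finset

namespace Nat.Partition

/-- Removing `j` copies of the part `d` is a bijection from the partitions of `n` in which `d`
occurs at least `j` times to the partitions of `n - d * j`. -/
theorem card_filter_le_count {n d j : ℕ} (hd : 0 < d) (h : d * j ≤ n) :
    #{q : Partition n | j ≤ q.parts.count d} = Fintype.card (Partition (n - d * j)) := by
  rw [← Finset.card_univ]
  refine Finset.card_bij'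
    (fun q hq ↦ ⟨q.parts - Multiset.replicate j d,
      fun {i} hi ↦ q.parts_pos (Multiset.mem_of_le tsub_le_self hi), ?_⟩)
    (fun q _ ↦ ⟨q.parts + Multiset.replicate j d, fun {i} hi ↦ ?_, ?_⟩) ?_ ?_ ?_ ?_
  · have hle : Multiset.replicate j d ≤ q.parts :=
      Multiset.le_count_iff_replicate_le.1 (Finset.mem_filter.1 hq).2
    have := congrArg Multiset.sum (tsub_add_cancel_of_le hle)
    rw [Multiset.sum_add, q.parts_sum, Multiset.sum_replicate, smul_eq_mul, mul_comm] at this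
    omega
  · rcases Multiset.mem_add.1 hi with hi | hi
    · exact q.parts_pos hi
    · rwa [Multiset.eq_of_mem_replicate hi]
  · rw [Multiset.sum_add, q.parts_sum, Multiset.sum_replicate, smul_eq_mul, mul_comm j]
    omega
  · simp
  · intro q _
    simp
  · intro q hq
    have hle : Multiset.replicate j d ≤ q.parts :=
      Multiset.le_count_iff_replicate_le.1 (Finset.mem_filter.1 hq).2
    exact Nat.Partition.ext (tsub_add_cancel_of_le hle)
  · intro q _
    exact Nat.Partition.ext (add_tsub_cancel_right _ _)

theorem mul_count_le {n : ℕ} (q : Partition n) (d : ℕ) : d * q.parts.count d ≤ n := by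
  have hle : Multiset.replicate (q.parts.count d) d ≤ q.parts :=
    Multiset.le_count_iff_replicate_le.1 le_rfl
  obtain ⟨t, ht⟩ := Multiset.le_iff_exists_add.1 hle
  have := congrArg Multiset.sum ht
  rw [Multiset.sum_add, q.parts_sum, Multiset.sum_replicate, smul_eq_mul, mul_comm] at this
  omega

theorem sum_mul_count {n : ℕ} (q : Partition n) :
    ∑ d ∈ Icc 1 n, d * q.parts.count d = n := by
  conv_rhs => rw [← q.parts_sum, Finset.sum_multiset_count]
  have hsub : q.parts.toFinset ⊆ Icc 1 n := by
    intro d hd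
    rw [Multiset.mem_toFinset] at hd
    exact Finset.mem_Icc.2 ⟨q.parts_pos hd, q.parts_sum ▸ Multiset.le_sum_of_mem hd⟩
  rw [← Finset.sum_subset hsub]
  · exact Finset.sum_congr rfl fun d _ ↦ by rw [smul_eq_mul, mul_comm]
  · intro d _ hd
    rw [Multiset.count_eq_zero_of_notMem (mt Multiset.mem_toFinset.2 hd), mul_zero]

theorem mul_card_eq_sum_sum (n : ℕ) :
    n * Fintype.card (Partition n) =
      ∑ d ∈ Icc 1 n, ∑ j ∈ Icc 1 n,
        if d * j ≤ n then d * Fintype.card (Partition (n - d * j)) else 0 := by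
  have hcount (q : Partition n) {d : ℕ} (hd : d ∈ Icc 1 n) :
      q.parts.count d = ∑ j ∈ Icc 1 n, if j ≤ q.parts.count d then 1 else 0 := by
    have h1 := (Finset.mem_Icc.1 hd).1
    have h2 := q.mul_count_le d
    have h3 : q.parts.count d ≤ n := by nlinarith
    rw [← Finset.card_filter]
    have : {j ∈ Icc 1 n | j ≤ q.parts.count d} = Icc 1 (q.parts.count d) := by
      ext j
      simp only [Finset.mem_filter, Finset.mem_Icc]
      omega
    simp [this]
  calc n * Fintype.card (Partition n)
      = ∑ q : Partition n, ∑ d ∈ Icc 1 n, d * q.parts.count d := by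
        simp [sum_mul_count, mul_comm]
    _ = ∑ d ∈ Icc 1 n, ∑ q : Partition n, d * q.parts.count d := Finset.sum_comm
    _ = _ := by
        refine Finset.sum_congr rfl fun d hd ↦ ?_
        have h1 := (Finset.mem_Icc.1 hd).1
        rw [← Finset.mul_sum, Finset.sum_congr rfl fun q _ ↦ hcount q hd, Finset.sum_comm,
          Finset.mul_sum]
        refine Finset.sum_congr rfl fun j _ ↦ ?_
        rw [← Finset.card_filter]
        split_ifs with h
        · rw [card_filter_le_count h1 h]
        · rw [Finset.filter_false_of_mem, Finset.card_empty, mul_zero]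
          intro q _ hj
          exact h ((Nat.mul_le_mul_left d hj).trans (q.mul_count_le d))

/-- The recurrence `n p(n) = ∑ σ(k) p(n - k)`. -/
theorem mul_card_eq_sum (n : ℕ) :
    n * Fintype.card (Partition n) =
      ∑ m ∈ range n, (∑ d ∈ (n - m).divisors, d) * Fintype.card (Partition m) := by
  rw [mul_card_eq_sum_sum]
  simp only [← Finset.sum_filter, Finset.sum_mul, Finset.sum_sigma']
  refine Finset.sum_bij' (fun x _ ↦ ⟨n - x.1 * x.2, x.1⟩) (fun y _ ↦ ⟨y.2, (n - y.1) / y.2⟩)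
    ?_ ?_ ?_ ?_ ?_
  · rintro ⟨d, j⟩ h
    simp only [Finset.mem_sigma, Finset.mem_Icc, Finset.mem_filter, Finset.mem_range,
      Nat.mem_divisors] at h ⊢
    have : 0 < d * j := Nat.mul_pos h.1.1 h.2.1.1
    rw [Nat.sub_sub_self h.2.2]
    exact ⟨by omega, dvd_mul_right _ _, by omega⟩
  · rintro ⟨m, d⟩ h
    simp only [Finset.mem_sigma, Finset.mem_Icc, Finset.mem_filter, Finset.mem_range,
      Nat.mem_divisors] at h ⊢
    have hle := Nat.le_of_dvd (by omega) h.2.1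
    have hd : 0 < d := Nat.pos_of_dvd_of_pos h.2.1 (by omega)
    refine ⟨⟨hd, by omega⟩, ⟨Nat.div_pos hle hd, (Nat.div_le_self _ _).trans (by omega)⟩, ?_⟩
    rw [Nat.mul_div_cancel' h.2.1]
    omega
  · rintro ⟨d, j⟩ h
    simp only [Finset.mem_sigma, Finset.mem_Icc, Finset.mem_filter] at h
    simp only [Nat.sub_sub_self h.2.2, Nat.mul_div_cancel_left j h.1.1]
  · rintro ⟨m, d⟩ h
    simp only [Finset.mem_sigma, Finset.mem_range, Nat.mem_divisors] at h
    simp only [Nat.mul_div_cancel' h.2.1, Nat.sub_sub_self h.1.le]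
  · rintro ⟨d, j⟩ _
    rfl

theorem card_zero : Fintype.card (Partition 0) = 1 := Fintype.card_unique

theorem card_one : Fintype.card (Partition 1) = 1 := Fintype.card_unique

theorem card_pos (n : ℕ) : 0 < Fintype.card (Partition n) := Fintype.card_pos

/-- The values `p(0), …, p(59)`. -/
def cardTable : List ℕ :=
  [1, 1, 2, 3, 5, 7, 11, 15, 22, 30, 42, 56, 77, 101, 135, 176, 231, 297, 385, 490, 627,
    792, 1002, 1255, 1575, 1958, 2436, 3010, 3718, 4565, 5604, 6842, 8349, 10143, 12310,
    14883, 17977, 21637, 26015, 31185, 37338, 44583, 53174, 63261, 75175, 89134, 105558,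
    124754, 147273, 173525, 204226, 239943, 281589, 329931, 386155, 451276, 526823, 614154,
    715220, 831820]

theorem cardTable_recurrence : ∀ n < 60, 0 < n →
    ∑ m ∈ range n, (∑ d ∈ (n - m).divisors, d) * cardTable.getD m 0 =
      n * cardTable.getD n 0 := by
  decide +kernel

theorem card_eq_cardTable {n : ℕ} (hn : n < 60) :
    Fintype.card (Partition n) = cardTable.getD n 0 := by
  induction n using Nat.strong_induction_on with
  | _ n ih =>
    rcases n.eq_zero_or_pos with rfl | h0
    · exact card_zero
    · refine Nat.eq_of_mul_eq_mul_left h0 ?_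
      rw [mul_card_eq_sum, ← cardTable_recurrence n hn h0]
      refine Finset.sum_congr rfl fun m hm ↦ ?_
      have hm := Finset.mem_range.1 hm
      rw [ih m hm (hm.trans hn)]

theorem two_mul_sum_divisors_le (n : ℕ) : 2 * ∑ d ∈ n.divisors, d ≤ n * (n + 1) := by
  have h1 : ∑ d ∈ n.divisors, d ≤ ∑ d ∈ range (n + 1), d :=
    Finset.sum_le_sum_of_subset fun d hd ↦
      Finset.mem_range.2 (Nat.lt_succ_of_le (Nat.divisor_le hd))
  have h2 := Finset.sum_range_id_mul_two (n + 1)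
  rw [Nat.add_sub_cancel] at h2
  linarith

theorem le_sum_divisors (n : ℕ) : n ≤ ∑ d ∈ n.divisors, d := by
  rcases n.eq_zero_or_pos with rfl | h
  · simp
  · exact Finset.single_le_sum (f := fun d ↦ d) (fun _ _ ↦ Nat.zero_le _)
      (Nat.mem_divisors_self n h.ne')

theorem sum_range_succ_sub_mul (f : ℕ → ℕ) (n : ℕ) :
    ∑ m ∈ range (n + 1), (n + 1 - m) * f m =
      ∑ m ∈ range n, (n - m) * f m + ∑ m ∈ range (n + 1), f m := by
  rw [Finset.sum_range_succ, Finset.sum_range_succ f, ← add_assoc, ← Finset.sum_add_distrib]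
  congr 1
  · refine Finset.sum_congr rfl fun m hm ↦ ?_
    rw [Nat.succ_sub (Finset.mem_range.1 hm).le, Nat.succ_mul]
  · rw [Nat.add_sub_cancel_left, one_mul]

theorem two_mul_sum_range_sub (n : ℕ) : 2 * ∑ m ∈ range n, (n - m) = n * (n + 1) := by
  induction n with
  | zero => rfl
  | succ n ih =>
    have h := sum_range_succ_sub_mul (fun _ ↦ 1) n
    simp only [mul_one, Finset.sum_const, Finset.card_range, smul_eq_mul] at h
    rw [h]
    linarith

theorem three_mul_sum_range_mul (n : ℕ) :
    3 * ∑ m ∈ range n, (m + 1) * (m + 2) = n * (n + 1) * (n + 2) := by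
  induction n with
  | zero => rfl
  | succ n ih =>
    rw [Finset.sum_range_succ]
    linarith

theorem twelve_mul_sum_range_sub_mul (n : ℕ) :
    12 * ∑ m ∈ range n, (n - m) * ((m + 1) * (m + 2)) = n * (n + 1) * (n + 2) * (n + 3) := by
  induction n with
  | zero => rfl
  | succ n ih =>
    have h := three_mul_sum_range_mul (n + 1)
    rw [sum_range_succ_sub_mul]
    linarith

theorem mul_lt_card {n : ℕ} (hn : 30 ≤ n) :
    5 * ((n + 1) * (n + 2)) < Fintype.card (Partition n) := by
  have hsmall : ∀ m < 60, 5 * ((m + 1) * (m + 2)) ≤ cardTable.getD m 0 + 1758 := by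
    decide +kernel
  have hmid : ∀ m < 60, 30 ≤ m → 5 * ((m + 1) * (m + 2)) < cardTable.getD m 0 := by
    decide +kernel
  induction n using Nat.strong_induction_on with
  | _ n ih =>
    rcases lt_or_ge n 60 with h | h
    · rw [card_eq_cardTable h]
      exact hmid n h hn
    have hm (m : ℕ) (h' : m < n) :
        5 * ((m + 1) * (m + 2)) ≤ Fintype.card (Partition m) + 1758 := by
      rcases lt_or_ge m 60 with h1 | h1
      · rw [card_eq_cardTable h1]
        exact hsmall m h1
      · exact (ih m h' (by omega)).le.trans (Nat.le_add_right _ _)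
    have h1 : 5 * ∑ m ∈ range n, (n - m) * ((m + 1) * (m + 2)) ≤
        n * Fintype.card (Partition n) + 1758 * ∑ m ∈ range n, (n - m) := by
      rw [mul_card_eq_sum, Finset.mul_sum, Finset.mul_sum, ← Finset.sum_add_distrib]
      refine Finset.sum_le_sum fun m h' ↦ ?_
      have h2 := Nat.mul_le_mul_left (n - m) (hm m (Finset.mem_range.1 h'))
      have h3 := Nat.mul_le_mul_right (Fintype.card (Partition m)) (le_sum_divisors (n - m))
      linarith
    have h2 := two_mul_sum_range_sub n
    have h3 := twelve_mul_sum_range_sub_mul n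
    by_contra! hcon
    have h4 := Nat.mul_le_mul_left n hcon
    have h5 : 5 * (n * (n + 1) * (n + 2) * (n + 3)) ≤
        12 * (n * (5 * ((n + 1) * (n + 2)))) + 6 * 1758 * (n * (n + 1)) := by linarith
    have h6 : n * (n + 1) * (5 * ((n + 2) * (n + 3))) ≤
        n * (n + 1) * (60 * (n + 2) + 6 * 1758) := by linarith
    have h7 := Nat.le_of_mul_le_mul_left h6 (by positivity)
    nlinarith

theorem card_add_two_le (n : ℕ) :
    Fintype.card (Partition (n + 2)) ≤
      Fintype.card (Partition (n + 1)) + Fintype.card (Partition n) := by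
  have hsmall : ∀ m < 58,
      cardTable.getD (m + 2) 0 ≤ cardTable.getD (m + 1) 0 + cardTable.getD m 0 := by
    decide +kernel
  induction n using Nat.strong_induction_on with
  | _ n ih =>
    rcases lt_or_ge n 58 with h | h
    · rw [card_eq_cardTable (n := n) (by omega), card_eq_cardTable (n := n + 1) (by omega),
        card_eq_cardTable (n := n + 2) (by omega)]
      exact hsmall n h
    have h0 := mul_card_eq_sum n
    have h1 := mul_card_eq_sum (n + 1)
    have h2 := mul_card_eq_sum (n + 2)
    rw [Finset.sum_range_succ'] at h1
    rw [Finset.sum_range_succ', Finset.sum_range_succ'] at h2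
    simp only [Nat.add_sub_add_right, add_assoc, Nat.reduceAdd, card_zero, card_one, zero_add,
      tsub_zero, mul_one] at h1 h2
    have h3 : ∑ m ∈ range n,
          (∑ d ∈ (n - m).divisors, d) * Fintype.card (Partition (m + 2)) ≤
        ∑ m ∈ range n, (∑ d ∈ (n - m).divisors, d) * Fintype.card (Partition (m + 1)) +
          ∑ m ∈ range n, (∑ d ∈ (n - m).divisors, d) * Fintype.card (Partition m) := by
      rw [← Finset.sum_add_distrib]
      refine Finset.sum_le_sum fun m hm ↦ ?_
      rw [← mul_add]
      exact Nat.mul_le_mul_left _ (ih m (Finset.mem_range.1 hm))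
    have h4 := two_mul_sum_divisors_le (n + 2)
    have h5 := mul_lt_card (n := n) (by omega)
    have h6 : ∑ d ∈ (n + 2).divisors, d ≤ Fintype.card (Partition n) := by nlinarith
    refine Nat.le_of_mul_le_mul_left (c := n + 2) ?_ (by omega)
    rw [h2, show n + 2 - 1 = n + 1 by omega]
    linarith

/-- A weak form of the Bessenrodt–Ono inequality for all `b ≥ 2`, with an error term which vanishes
unless `1 ≤ m ≤ 5`. -/
theorem card_add_le_of_lt {b : ℕ} (hb : 1 < b) (m : ℕ)
    (h : 1 < m → 9 < m + b → Fintype.card (Partition (m + b)) <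
      Fintype.card (Partition m) * Fintype.card (Partition b)) :
    Fintype.card (Partition (b + m)) ≤
      Fintype.card (Partition m) * Fintype.card (Partition b) +
        if m = 1 then Fintype.card (Partition (b - 1)) else
          if m ∈ Icc 2 5 then 2 else 0 := by
  rcases Nat.lt_or_ge m 2 with h2 | h2
  · interval_cases m
    · simp
    · obtain ⟨c, rfl⟩ : ∃ c, b = c + 1 := ⟨b - 1, by omega⟩
      simpa [card_one] using card_add_two_le c
  · rcases Nat.lt_or_ge 9 (m + b) with h9 | h9
    · rw [add_comm b m]
      exact (h h2 h9).le.trans (Nat.le_add_right _ _)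
    · have hsmall : ∀ b < 10, ∀ m < 10, 2 ≤ b → 2 ≤ m → m + b ≤ 9 →
          cardTable.getD (b + m) 0 ≤ cardTable.getD m 0 * cardTable.getD b 0 +
            if m ∈ Icc 2 5 then 2 else 0 := by
        decide +kernel
      rw [card_eq_cardTable (n := m) (by omega), card_eq_cardTable (n := b) (by omega),
        card_eq_cardTable (n := b + m) (by omega), if_neg (by omega)]
      exact hsmall b (by omega) m (by omega) hb h2 h9

end Nat.Partition

open Nat.Partition in
theorem Nat.Partition.card_add_lt_of_le {a b : ℕ} (hb : 1 < b) (hba : b ≤ a) (ha : 30 ≤ a)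
    (ih : ∀ m < a, 1 < m → 9 < m + b → Fintype.card (Partition (m + b)) <
      Fintype.card (Partition m) * Fintype.card (Partition b)) :
    Fintype.card (Partition (a + b)) <
      Fintype.card (Partition a) * Fintype.card (Partition b) := by
  have hlow := mul_lt_card ha
  obtain ⟨c, rfl⟩ : ∃ c, b = c + 1 := ⟨b - 1, by omega⟩
  obtain ⟨e, rfl⟩ : ∃ e, a = e + 6 := ⟨a - 6, by omega⟩
  set a := e + 6 with hae
  have hrec := mul_card_eq_sum (c + 1 + a)
  rw [Finset.sum_range_add] at hrec
  have hupper : ∑ m ∈ range a, (∑ d ∈ (c + 1 + a - (c + 1 + m)).divisors, d) *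
        Fintype.card (Partition (c + 1 + m)) ≤
      a * Fintype.card (Partition a) * Fintype.card (Partition (c + 1)) +
        a * (a + 1) / 2 * (9 * Fintype.card (Partition c)) := by
    have hterm : ∀ m ∈ range a, (∑ d ∈ (c + 1 + a - (c + 1 + m)).divisors, d) *
          Fintype.card (Partition (c + 1 + m)) ≤
        (∑ d ∈ (a - m).divisors, d) * Fintype.card (Partition m) *
          Fintype.card (Partition (c + 1)) +
        a * (a + 1) / 2 * (if m = 1 then Fintype.card (Partition c) else
          if m ∈ Icc 2 5 then 2 else 0) := by
      intro m hm
      have h1 := card_add_le_of_lt hb m (ih m (Finset.mem_range.1 hm))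
      rw [Nat.add_sub_cancel] at h1
      have h2 : ∑ d ∈ (a - m).divisors, d ≤ a * (a + 1) / 2 := by
        rw [Nat.le_div_iff_mul_le two_pos, mul_comm]
        exact (two_mul_sum_divisors_le _).trans
          (Nat.mul_le_mul (Nat.sub_le _ _) (Nat.succ_le_succ (Nat.sub_le _ _)))
      rw [Nat.add_sub_add_left]
      refine (Nat.mul_le_mul_left _ h1).trans ?_
      rw [mul_add, mul_assoc]
      exact Nat.add_le_add_left (Nat.mul_le_mul_right _ h2) _
    refine (Finset.sum_le_sum hterm).trans ?_
    rw [Finset.sum_add_distrib, ← Finset.sum_mul, ← mul_card_eq_sum, ← Finset.mul_sum]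
    refine Nat.add_le_add_left (Nat.mul_le_mul_left _ ?_) _
    have hc := card_pos c
    have hzero : ∑ x ∈ range e, (if 6 + x = 1 then Fintype.card (Partition c) else
        if 6 + x ∈ Icc 2 5 then 2 else 0) = 0 := by
      refine Finset.sum_eq_zero fun x _ ↦ ?_
      rw [if_neg (by omega), if_neg (by simp only [Finset.mem_Icc]; omega)]
    rw [hae, add_comm e 6, Finset.sum_range_add, hzero]
    simp only [Finset.sum_range_succ, Finset.sum_range_zero, Finset.mem_Icc]
    norm_num
    omega
  have hlower : ∑ m ∈ range (c + 1), (∑ d ∈ (c + 1 + a - m).divisors, d) *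
        Fintype.card (Partition m) + Fintype.card (Partition a) * Fintype.card (Partition c) ≤
      Fintype.card (Partition a) * ((c + 1) * Fintype.card (Partition (c + 1))) +
        (a + 1) * (a + 2) / 2 * Fintype.card (Partition c) := by
    have hterm : ∀ m ∈ range c, (∑ d ∈ (c + 1 + a - m).divisors, d) *
          Fintype.card (Partition m) ≤
        Fintype.card (Partition a) *
          ((∑ d ∈ (c + 1 - m).divisors, d) * Fintype.card (Partition m)) := by
      intro m hm
      have hm := Finset.mem_range.1 hm
      obtain ⟨j, hj⟩ : ∃ j, c + 1 = m + (j + 1) := ⟨c - m, by omega⟩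
      rw [hj, show m + (j + 1) + a - m = a + (j + 1) by omega, Nat.add_sub_cancel_left,
        ← mul_assoc]
      refine Nat.mul_le_mul_right _ ?_
      have h1 := two_mul_sum_divisors_le (a + (j + 1))
      have h2 := Nat.mul_le_mul hlow.le (le_sum_divisors (j + 1))
      have h3 : (a + (j + 1)) * (a + (j + 1) + 1) ≤ ((a + 1) * (j + 1)) * (2 * a + 1) :=
        Nat.mul_le_mul (by nlinarith) (by omega)
      nlinarith
    have h1 := two_mul_sum_divisors_le (a + 1)
    have h2 : ∑ d ∈ (a + 1).divisors, d ≤ (a + 1) * (a + 2) / 2 := by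
      rw [Nat.le_div_iff_mul_le two_pos]
      linarith
    rw [mul_card_eq_sum, Finset.sum_range_succ, Finset.sum_range_succ, mul_add, Finset.mul_sum,
      show c + 1 + a - c = a + 1 by omega, show c + 1 - c = 1 by omega, Nat.divisors_one,
      Finset.sum_singleton, one_mul]
    have h3 := Nat.mul_le_mul_right (Fintype.card (Partition c)) h2
    have h4 := Finset.sum_le_sum hterm
    omega
  have hgap : a * (a + 1) / 2 * (9 * Fintype.card (Partition c)) +
      (a + 1) * (a + 2) / 2 * Fintype.card (Partition c) <
        Fintype.card (Partition a) * Fintype.card (Partition c) := by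
    rw [← mul_assoc, ← add_mul]
    refine Nat.mul_lt_mul_of_pos_right ?_ (card_pos c)
    have h1 := Nat.div_mul_le_self (a * (a + 1)) 2
    have h2 := Nat.div_mul_le_self ((a + 1) * (a + 2)) 2
    nlinarith
  rw [add_comm a]
  refine Nat.lt_of_mul_lt_mul_left (a := c + 1 + a) ?_
  rw [hrec]
  linarith

open Nat.Partition in
theorem partition_bessenrodt_ono (a b : ℕ) (ha : 1 < a) (hb : 1 < b) (hab : 9 < a + b) :
    Fintype.card (Nat.Partition a) * Fintype.card (Nat.Partition b) >
      Fintype.card (Nat.Partition (a + b)) := by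
  have hsmall : ∀ a < 30, ∀ b < 30, 1 < a → 1 < b → 9 < a + b →
      cardTable.getD (a + b) 0 < cardTable.getD a 0 * cardTable.getD b 0 := by
    decide +kernel
  obtain ⟨s, hs⟩ : ∃ s, a + b = s := ⟨_, rfl⟩
  induction s using Nat.strong_induction_on generalizing a b with
  | _ s ih =>
    wlog hba : b ≤ a generalizing a b
    · rw [mul_comm, add_comm a b]
      exact this b a hb ha (by omega) (by omega) (by omega)
    rcases lt_or_ge a 30 with h | h
    · rw [card_eq_cardTable (n := a) (by omega), card_eq_cardTable (n := b) (by omega),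
        card_eq_cardTable (n := a + b) (by omega)]
      exact hsmall a h b (by omega) ha hb hab
    · exact card_add_lt_of_le hb hba h fun m hm h1 h9 ↦
        ih (m + b) (by omega) m b h1 hb h9 rfl
end

section
/- Let k ≥ 2 and let a ≥ b ≥ 1 be positive integers. Then p_{-k}(a) · p_{-k}(b) > p_{-k}(a + b), except for the four triples (a, b, k) = (1,1,2), (2,1,2), (3,1,2), (1,1,3). -/
/-- A `k`-colored partition of `n`: a multiset of pairs `(m, c)` where `m` is a positive
part size and `c ∈ {0, …, k-1}` is a color (color `j` of the paper corresponds to `j - 1`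
here), such that the part sizes sum to `n`. -/
structure ColoredPartition (k n : ℕ) where
  parts : Multiset (ℕ × ℕ)
  parts_pos : ∀ p ∈ parts, 0 < p.1
  parts_color : ∀ p ∈ parts, p.2 < k
  parts_sum : (parts.map Prod.fst).sum = n

/-- `p_{-k}(n)`, the number of `k`-colored partitions of `n`. -/
noncomputable def coloredPartitions (k n : ℕ) : ℕ := Nat.card (ColoredPartition k n)

/-- `p_{-k}(n | avoiding s)`: the number of `k`-colored partitions of `n` containing
no part belonging to the set `s` of (size, color) pairs. -/
noncomputable def coloredPartitionsAvoiding (k n : ℕ) (s : Set (ℕ × ℕ)) : ℕ :=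
  Nat.card {p : ColoredPartition k n // ∀ x ∈ s, x ∉ p.parts}

open Finset

/-- The underlying multisets of the `k`-colored partitions of `n`, as a finset. -/
def coloredPartitionFinset (k n : ℕ) : Finset (Multiset (ℕ × ℕ)) :=
  (Finset.Iic (n • (Icc 1 n ×ˢ range k).val)).filter fun s =>
    (∀ p ∈ s, 0 < p.1) ∧ (∀ p ∈ s, p.2 < k) ∧ (s.map Prod.fst).sum = n

theorem count_mul_le_sum_map_fst (s : Multiset (ℕ × ℕ)) (p : ℕ × ℕ) :
    s.count p * p.1 ≤ (s.map Prod.fst).sum := by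
  obtain ⟨t, ht⟩ := Multiset.le_iff_exists_add.1
    (Multiset.le_count_iff_replicate_le.1 (le_refl (s.count p)))
  rw [congrArg (fun u => (Multiset.map Prod.fst u).sum) ht]
  simp

theorem mem_coloredPartitionFinset {k n : ℕ} {s : Multiset (ℕ × ℕ)} :
    s ∈ coloredPartitionFinset k n ↔
      (∀ p ∈ s, 0 < p.1) ∧ (∀ p ∈ s, p.2 < k) ∧ (s.map Prod.fst).sum = n := by
  simp only [coloredPartitionFinset, mem_filter, Finset.mem_Iic, and_iff_right_iff_imp]
  rintro ⟨hpos, hcol, hsum⟩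
  rw [Multiset.le_iff_count]
  intro p
  by_cases hp : p ∈ s
  · have hle := count_mul_le_sum_map_fst s p
    have hc : 1 ≤ s.count p := Multiset.one_le_count_iff_mem.2 hp
    have h0 := hpos p hp
    have hmem : p ∈ Icc 1 n ×ˢ range k := by
      simp only [mem_product, mem_Icc, mem_range]
      exact ⟨⟨h0, by nlinarith⟩, hcol p hp⟩
    rw [Multiset.count_nsmul, Multiset.count_eq_one_of_mem (Finset.nodup _) hmem]
    nlinarith
  · simp [Multiset.count_eq_zero_of_notMem hp]

theorem coloredPartitions_eq_card (k n : ℕ) :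
    coloredPartitions k n = #(coloredPartitionFinset k n) := by
  rw [coloredPartitions, ← Nat.card_eq_finsetCard]
  refine Nat.card_congr
    { toFun := fun p => ⟨p.parts, mem_coloredPartitionFinset.2
        ⟨p.parts_pos, p.parts_color, p.parts_sum⟩⟩
      invFun := fun s =>
        have h := mem_coloredPartitionFinset.1 s.2
        ⟨s.1, h.1, h.2.1, h.2.2⟩
      left_inv := fun _ => rfl
      right_inv := fun _ => rfl }

theorem coloredPartitions_zero (k : ℕ) : coloredPartitions k 0 = 1 := by
  rw [coloredPartitions_eq_card, card_eq_one]
  refine ⟨0, ?_⟩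
  ext s
  rw [mem_coloredPartitionFinset, mem_singleton]
  constructor
  · rintro ⟨hpos, -, hsum⟩
    refine Multiset.eq_zero_of_forall_notMem fun p hp => ?_
    have h := hpos p hp
    have := (Multiset.sum_eq_zero_iff.1 hsum) p.1 (Multiset.mem_map_of_mem _ hp)
    omega
  · rintro rfl
    simp

/-- Removing `r` copies of a given colored part. -/
theorem card_filter_le_count {k n r : ℕ} {p : ℕ × ℕ} (hp : 0 < p.1) (hpk : p.2 < k) :
    #((coloredPartitionFinset k n).filter fun s => r ≤ s.count p) =
      if p.1 * r ≤ n then coloredPartitions k (n - p.1 * r) else 0 := by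
  split_ifs with hle
  · rw [coloredPartitions_eq_card]
    symm
    refine card_bij' (fun s _ => s + Multiset.replicate r p)
      (fun s _ => s - Multiset.replicate r p) ?_ ?_ ?_ ?_
    · intro s hs
      obtain ⟨hpos, hcol, hsum⟩ := mem_coloredPartitionFinset.1 hs
      rw [mem_filter, mem_coloredPartitionFinset]
      refine ⟨⟨fun q hq => ?_, fun q hq => ?_, ?_⟩, by simp⟩
      · rcases Multiset.mem_add.1 hq with h | h
        · exact hpos q h
        · rwa [Multiset.eq_of_mem_replicate h]
      · rcases Multiset.mem_add.1 hq with h | h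
        · exact hcol q h
        · rwa [Multiset.eq_of_mem_replicate h]
      · have : r * p.1 = p.1 * r := mul_comm _ _
        simp [hsum]
        omega
    · intro s hs
      rw [mem_filter, mem_coloredPartitionFinset] at hs
      obtain ⟨⟨hpos, hcol, hsum⟩, hr⟩ := hs
      rw [mem_coloredPartitionFinset]
      have hsub := Multiset.sub_le_self s (Multiset.replicate r p)
      refine ⟨fun q hq => hpos q (Multiset.mem_of_le hsub hq),
        fun q hq => hcol q (Multiset.mem_of_le hsub hq), ?_⟩
      have hadd := congrArg (fun u => (Multiset.map Prod.fst u).sum)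
        (tsub_add_cancel_of_le (Multiset.le_count_iff_replicate_le.1 hr))
      have : r * p.1 = p.1 * r := mul_comm _ _
      simp [hsum] at hadd
      omega
    · intro s _
      simp
    · intro s hs
      exact tsub_add_cancel_of_le (Multiset.le_count_iff_replicate_le.1 (mem_filter.1 hs).2)
  · rw [card_eq_zero, filter_eq_empty_iff]
    intro s hs hr
    have hsum := (mem_coloredPartitionFinset.1 hs).2.2
    have := count_mul_le_sum_map_fst s p
    nlinarith

theorem sum_map_fst_eq {k n : ℕ} {s : Multiset (ℕ × ℕ)} (hs : s ∈ coloredPartitionFinset k n) :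
    n = ∑ p ∈ Icc 1 n ×ˢ range k, p.1 * ∑ r ∈ Icc 1 n, if r ≤ s.count p then 1 else 0 := by
  obtain ⟨hpos, hcol, hsum⟩ := mem_coloredPartitionFinset.1 hs
  have hbound : ∀ p ∈ s, p.1 ≤ n ∧ s.count p ≤ n := fun p hp => by
    have h1 := count_mul_le_sum_map_fst s p
    have h2 := Multiset.one_le_count_iff_mem.2 hp
    have h3 := hpos p hp
    constructor <;> nlinarith
  conv_lhs => rw [← hsum, Finset.sum_multiset_map_count]
  refine sum_subset_zero_on_sdiff (s₁ := s.toFinset) ?_ ?_ ?_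
  · intro p hp
    rw [Multiset.mem_toFinset] at hp
    simp only [mem_product, mem_Icc, mem_range]
    exact ⟨⟨hpos p hp, (hbound p hp).1⟩, hcol p hp⟩
  · intro p hp
    rw [mem_sdiff, Multiset.mem_toFinset] at hp
    rw [Multiset.count_eq_zero_of_notMem hp.2, sum_eq_zero, mul_zero]
    intro r hr
    rw [mem_Icc] at hr
    rw [if_neg (by omega)]
  · intro p hp
    have hb := hbound p (Multiset.mem_toFinset.1 hp)
    have : (Icc 1 n).filter (fun r => r ≤ s.count p) = Icc 1 (s.count p) := by
      ext r
      simp only [mem_filter, mem_Icc]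
      omega
    rw [← card_filter, this, Nat.card_Icc, smul_eq_mul, mul_comm, Nat.add_sub_cancel]

theorem sum_Icc_sum_Icc_mul (f : ℕ → ℕ) (n : ℕ) :
    ∑ m ∈ Icc 1 n, ∑ r ∈ Icc 1 n, (if m * r ≤ n then m * f (n - m * r) else 0) =
      ∑ t ∈ Icc 1 n, (∑ d ∈ t.divisors, d) * f (n - t) := by
  simp_rw [sum_mul]
  rw [← sum_product', ← sum_filter, sum_sigma']
  refine sum_bij' (fun x _ => ⟨x.1 * x.2, x.1⟩) (fun y _ => (y.2, y.1 / y.2)) ?_ ?_ ?_ ?_ ?_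
  · rintro ⟨m, r⟩ h
    simp only [mem_filter, mem_product, mem_Icc] at h
    simp only [mem_sigma, mem_Icc, Nat.mem_divisors]
    have : 0 < m * r := Nat.mul_pos (by omega) (by omega)
    exact ⟨⟨this, h.2⟩, Nat.dvd_mul_right _ _, this.ne'⟩
  · rintro ⟨t, d⟩ h
    simp only [mem_sigma, mem_Icc, Nat.mem_divisors] at h
    obtain ⟨⟨h1, h2⟩, ⟨e, rfl⟩, h3⟩ := h
    have hd : 0 < d := Nat.pos_of_ne_zero fun h => by simp [h] at h3
    have he : 0 < e := Nat.pos_of_ne_zero fun h => by simp [h] at h3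
    simp only [mem_filter, mem_product, mem_Icc, Nat.mul_div_cancel_left _ hd]
    refine ⟨⟨⟨hd, ?_⟩, he, ?_⟩, h2⟩ <;> nlinarith
  · rintro ⟨m, r⟩ h
    simp only [mem_filter, mem_product, mem_Icc] at h
    simp [Nat.mul_div_cancel_left r (show 0 < m by omega)]
  · rintro ⟨t, d⟩ h
    simp only [mem_sigma, mem_Icc, Nat.mem_divisors] at h
    simp [Nat.mul_div_cancel' h.2.1]
  · rintro ⟨m, r⟩ h
    rfl

/-- The logarithmic-derivative recurrence for `k`-colored partitions. -/
theorem mul_coloredPartitions (k n : ℕ) :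
    n * coloredPartitions k n =
      k * ∑ i ∈ range n, (∑ d ∈ (n - i).divisors, d) * coloredPartitions k i := by
  have hreflect : ∑ i ∈ range n, (∑ d ∈ (n - i).divisors, d) * coloredPartitions k i =
      ∑ t ∈ Icc 1 n, (∑ d ∈ t.divisors, d) * coloredPartitions k (n - t) := by
    refine sum_bij' (fun i _ => n - i) (fun t _ => n - t) ?_ ?_ ?_ ?_ ?_ <;>
      intro i hi <;> simp only [mem_range, mem_Icc] at hi ⊢
    · omega
    · omega
    · omega
    · omega
    · rw [show n - (n - i) = i by omega]
  calc n * coloredPartitions k n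
      = ∑ s ∈ coloredPartitionFinset k n, ∑ p ∈ Icc 1 n ×ˢ range k,
          p.1 * ∑ r ∈ Icc 1 n, if r ≤ s.count p then 1 else 0 := by
        rw [← sum_congr rfl fun s hs => sum_map_fst_eq hs, sum_const, smul_eq_mul, mul_comm,
          coloredPartitions_eq_card]
    _ = ∑ p ∈ Icc 1 n ×ˢ range k, ∑ r ∈ Icc 1 n,
          (if p.1 * r ≤ n then p.1 * coloredPartitions k (n - p.1 * r) else 0) := by
        rw [sum_comm]
        refine sum_congr rfl fun p hp => ?_
        simp only [mem_product, mem_Icc, mem_range] at hp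
        rw [← mul_sum, sum_comm, mul_sum]
        refine sum_congr rfl fun r _ => ?_
        rw [← card_filter, card_filter_le_count hp.1.1 hp.2, mul_ite, mul_zero]
    _ = k * ∑ m ∈ Icc 1 n, ∑ r ∈ Icc 1 n,
          (if m * r ≤ n then m * coloredPartitions k (n - m * r) else 0) := by
        rw [sum_product, mul_sum]
        simp
    _ = _ := by rw [sum_Icc_sum_Icc_mul, hreflect]

theorem coloredPartitions_pos {k : ℕ} (hk : 1 ≤ k) (n : ℕ) : 0 < coloredPartitions k n := by
  rcases Nat.eq_zero_or_pos n with rfl | hn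
  · simp [coloredPartitions_zero]
  · refine Nat.pos_of_ne_zero fun h => ?_
    have hrec := mul_coloredPartitions k n
    rw [h, mul_zero, eq_comm, mul_eq_zero, sum_eq_zero_iff] at hrec
    have h0 := (hrec.resolve_left (by omega)) 0 (mem_range.2 hn)
    rw [coloredPartitions_zero, Nat.sub_zero, mul_one, sum_eq_zero_iff] at h0
    have := h0 1 (Nat.one_mem_divisors.2 hn.ne')
    omega

theorem coloredPartitions_mono {k l : ℕ} (h : k ≤ l) (n : ℕ) :
    coloredPartitions k n ≤ coloredPartitions l n := by
  induction n using Nat.strong_induction_on with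
  | _ n ih =>
    rcases Nat.eq_zero_or_pos n with rfl | hn
    · simp [coloredPartitions_zero]
    · refine Nat.le_of_mul_le_mul_left ?_ hn
      rw [mul_coloredPartitions, mul_coloredPartitions]
      gcongr with i hi
      exact ih i (mem_range.1 hi)

theorem coloredPartitions_one (k : ℕ) : coloredPartitions k 1 = k := by
  have := mul_coloredPartitions k 1
  simpa [coloredPartitions_zero] using this

theorem two_mul_coloredPartitions_two (k : ℕ) :
    2 * coloredPartitions k 2 = k * (k + 3) := by
  rw [mul_coloredPartitions, sum_range_succ, sum_range_one, coloredPartitions_zero,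
    coloredPartitions_one, show ∑ d ∈ ((2 : ℕ) - 0).divisors, d = 3 by decide,
    show ∑ d ∈ ((2 : ℕ) - 1).divisors, d = 1 by decide]
  ring

/-- The first values of the two-colored partition function. -/
theorem coloredPartitions_two_values :
    coloredPartitions 2 2 = 5 ∧ coloredPartitions 2 3 = 10 ∧ coloredPartitions 2 4 = 20 ∧
    coloredPartitions 2 5 = 36 ∧ coloredPartitions 2 6 = 65 ∧ coloredPartitions 2 7 = 110 ∧
    coloredPartitions 2 8 = 185 ∧ coloredPartitions 2 9 = 300 ∧ coloredPartitions 2 10 = 481 ∧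
    coloredPartitions 2 11 = 752 ∧ coloredPartitions 2 12 = 1165 ∧
    coloredPartitions 2 13 = 1770 := by
  have s1 : ∑ d ∈ Nat.divisors 1, d = 1 := by decide
  have s2 : ∑ d ∈ Nat.divisors 2, d = 3 := by decide
  have s3 : ∑ d ∈ Nat.divisors 3, d = 4 := by decide
  have s4 : ∑ d ∈ Nat.divisors 4, d = 7 := by decide
  have s5 : ∑ d ∈ Nat.divisors 5, d = 6 := by decide
  have s6 : ∑ d ∈ Nat.divisors 6, d = 12 := by decide
  have s7 : ∑ d ∈ Nat.divisors 7, d = 8 := by decide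
  have s8 : ∑ d ∈ Nat.divisors 8, d = 15 := by decide
  have s9 : ∑ d ∈ Nat.divisors 9, d = 13 := by decide
  have s10 : ∑ d ∈ Nat.divisors 10, d = 18 := by decide
  have s11 : ∑ d ∈ Nat.divisors 11, d = 12 := by decide
  have s12 : ∑ d ∈ Nat.divisors 12, d = 28 := by decide
  have s13 : ∑ d ∈ Nat.divisors 13, d = 14 := by decide
  have r := mul_coloredPartitions 2
  have v0 := coloredPartitions_zero 2
  have v1 := coloredPartitions_one 2
  have r2 := r 2
  have r3 := r 3
  have r4 := r 4
  have r5 := r 5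
  have r6 := r 6
  have r7 := r 7
  have r8 := r 8
  have r9 := r 9
  have r10 := r 10
  have r11 := r 11
  have r12 := r 12
  have r13 := r 13
  simp only [sum_range_succ, sum_range_zero, Nat.reduceSub, s1, s2, s3, s4, s5, s6, s7, s8, s9,
    s10, s11, s12, s13, v0, v1] at r2 r3 r4 r5 r6 r7 r8 r9 r10 r11 r12 r13
  omega

theorem le_sum_divisors {n : ℕ} (hn : 0 < n) : n ≤ ∑ d ∈ n.divisors, d :=
  single_le_sum (f := fun d => d) (fun _ _ => Nat.zero_le _) (Nat.mem_divisors_self n hn.ne')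

theorem two_mul_sum_divisors_le (n : ℕ) : 2 * ∑ d ∈ n.divisors, d ≤ n * (n + 1) := by
  have hsub : n.divisors ⊆ range (n + 1) := fun d hd =>
    mem_range.2 (Nat.lt_succ_of_le (Nat.divisor_le hd))
  have h := sum_le_sum_of_subset (f := fun d => d) hsub
  have := sum_range_id_mul_two (n + 1)
  rw [Nat.add_sub_cancel] at this
  linarith

theorem two_mul_sum_le_mul_coloredPartitions (n : ℕ) :
    (2 : ℤ) * ∑ i ∈ range n, ((n : ℤ) - i) * coloredPartitions 2 i ≤
      n * coloredPartitions 2 n := by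
  have h := mul_coloredPartitions 2 n
  zify at h
  rw [h]
  gcongr with i hi
  have hi := mem_range.1 hi
  have := le_sum_divisors (Nat.sub_pos_of_lt hi)
  zify [hi.le] at this
  exact this

theorem succ_le_coloredPartitions_two (n : ℕ) : (n : ℤ) + 1 ≤ coloredPartitions 2 n := by
  rcases Nat.eq_zero_or_pos n with rfl | hn
  · simp [coloredPartitions_zero]
  have hsum : ∀ N : ℤ, ∀ j : ℕ, 2 * ∑ i ∈ range j, (N - i) * 1 = j * (2 * N - j + 1) := by
    intro N j
    induction j with
    | zero => simp
    | succ j ih => rw [sum_range_succ, mul_add, ih]; push_cast; ring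
  have hle : ∑ i ∈ range n, ((n : ℤ) - i) * 1 ≤
      ∑ i ∈ range n, ((n : ℤ) - i) * coloredPartitions 2 i := by
    gcongr with i hi
    · have := mem_range.1 hi
      omega
    · exact_mod_cast coloredPartitions_pos (by norm_num) i
  have h1 := two_mul_sum_le_mul_coloredPartitions n
  have h2 := hsum n n
  refine le_of_mul_le_mul_left (a := (n : ℤ)) ?_ (by exact_mod_cast hn)
  linarith

theorem quadratic_le_coloredPartitions_two (n : ℕ) :
    ((n : ℤ) + 1) * (n + 2) ≤ 3 * coloredPartitions 2 n := by
  rcases Nat.eq_zero_or_pos n with rfl | hn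
  · simp [coloredPartitions_zero]
  have hsum : ∀ N : ℤ, ∀ j : ℕ, 6 * ∑ i ∈ range j, (N - i) * ((i : ℤ) + 1) =
      j * (j + 1) * (3 * N - 2 * j + 2) := by
    intro N j
    induction j with
    | zero => simp
    | succ j ih => rw [sum_range_succ, mul_add, ih]; push_cast; ring
  have hle : ∑ i ∈ range n, ((n : ℤ) - i) * ((i : ℤ) + 1) ≤
      ∑ i ∈ range n, ((n : ℤ) - i) * coloredPartitions 2 i := by
    gcongr with i hi
    · have := mem_range.1 hi
      omega
    · exact succ_le_coloredPartitions_two i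
  have h1 := two_mul_sum_le_mul_coloredPartitions n
  have h2 := hsum n n
  refine le_of_mul_le_mul_left (a := (n : ℤ)) ?_ (by exact_mod_cast hn)
  linarith

theorem cubic_le_coloredPartitions_two (n : ℕ) :
    ((n : ℤ) + 1) * (n + 2) * (n + 3) ≤ 18 * coloredPartitions 2 n := by
  rcases Nat.eq_zero_or_pos n with rfl | hn
  · simp [coloredPartitions_zero]
  have hsum : ∀ N : ℤ, ∀ j : ℕ, 12 * ∑ i ∈ range j, (N - i) * (((i : ℤ) + 1) * (i + 2)) =
      j * (j + 1) * (j + 2) * (4 * N - 3 * j + 3) := by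
    intro N j
    induction j with
    | zero => simp
    | succ j ih => rw [sum_range_succ, mul_add, ih]; push_cast; ring
  have hle : ∑ i ∈ range n, ((n : ℤ) - i) * (((i : ℤ) + 1) * (i + 2)) ≤
      ∑ i ∈ range n, ((n : ℤ) - i) * (3 * coloredPartitions 2 i) := by
    refine sum_le_sum fun i hi => mul_le_mul_of_nonneg_left
      (quadratic_le_coloredPartitions_two i) ?_
    have := mem_range.1 hi
    omega
  have h1 := two_mul_sum_le_mul_coloredPartitions n
  have h2 := hsum n n
  have h3 : ∑ i ∈ range n, ((n : ℤ) - i) * (3 * coloredPartitions 2 i) =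
      3 * ∑ i ∈ range n, ((n : ℤ) - i) * coloredPartitions 2 i := by
    rw [mul_sum]
    exact sum_congr rfl fun i _ => by ring
  refine le_of_mul_le_mul_left (a := (n : ℤ)) ?_ (by exact_mod_cast hn)
  linarith

theorem lt_two_mul_coloredPartitions_two {a : ℕ} (ha : 5 ≤ a) :
    (a + 1) * (2 * a + 1) < 2 * coloredPartitions 2 a := by
  rcases Nat.lt_or_ge a 14 with h | h
  · obtain ⟨-, -, -, v5, v6, v7, v8, v9, v10, v11, v12, v13⟩ := coloredPartitions_two_values
    interval_cases a <;> omega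
  · have hc := cubic_le_coloredPartitions_two a
    zify at h ⊢
    nlinarith [mul_nonneg (show (0 : ℤ) ≤ a + 1 by positivity)
      (mul_nonneg (sub_nonneg.2 h) (show (0 : ℤ) ≤ a by positivity))]

theorem sum_divisors_add_lt {a j : ℕ} (ha : 2 ≤ a) (hj : 1 ≤ j) (hja : j ≤ a) :
    ∑ d ∈ (a + j).divisors, d < (∑ d ∈ j.divisors, d) * coloredPartitions 2 a := by
  rcases Nat.lt_or_ge a 5 with h | h
  · obtain ⟨v2, v3, v4, -⟩ := coloredPartitions_two_values
    interval_cases a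
    · rw [v2]; interval_cases j <;> decide
    · rw [v3]; interval_cases j <;> decide
    · rw [v4]; interval_cases j <;> decide
  · have h1 := lt_two_mul_coloredPartitions_two h
    have h2 := two_mul_sum_divisors_le (a + j)
    have h3 := Nat.mul_le_mul_right (coloredPartitions 2 a) (le_sum_divisors hj)
    have h4 : (a + j) * (a + j + 1) ≤ j * ((a + 1) * (2 * a + 1)) := by
      have h5 : a + j ≤ j * (a + 1) := by nlinarith
      calc (a + j) * (a + j + 1) ≤ (j * (a + 1)) * (2 * a + 1) :=
            Nat.mul_le_mul h5 (by omega)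
        _ = _ := by ring
    have h5 := Nat.mul_lt_mul_of_pos_left h1 hj
    nlinarith

theorem add_mul_coloredPartitions_add (k a b : ℕ) :
    (a + b) * coloredPartitions k (a + b) =
      k * (∑ i ∈ range b, (∑ d ∈ (a + (b - i)).divisors, d) * coloredPartitions k i +
        ∑ i ∈ range a, (∑ d ∈ (a - i).divisors, d) * coloredPartitions k (b + i)) := by
  rw [mul_coloredPartitions, add_comm a b, sum_range_add]
  congr 2
  · refine sum_congr rfl fun i hi => ?_
    have := mem_range.1 hi
    rw [show b + a - i = a + (b - i) by omega]
  · refine sum_congr rfl fun i hi => ?_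
    rw [show b + a - (b + i) = a - i by omega]

theorem add_mul_coloredPartitions_mul (k a b : ℕ) :
    (a + b) * (coloredPartitions k a * coloredPartitions k b) =
      k * (∑ i ∈ range b, (∑ d ∈ (b - i).divisors, d) * coloredPartitions k a *
          coloredPartitions k i +
        ∑ i ∈ range a, (∑ d ∈ (a - i).divisors, d) *
          (coloredPartitions k i * coloredPartitions k b)) := by
  have h1 : ∑ i ∈ range b, (∑ d ∈ (b - i).divisors, d) * coloredPartitions k a *
      coloredPartitions k i = (∑ i ∈ range b, (∑ d ∈ (b - i).divisors, d) *
      coloredPartitions k i) * coloredPartitions k a := by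
    rw [sum_mul]
    exact sum_congr rfl fun i _ => by ring
  have h2 : ∑ i ∈ range a, (∑ d ∈ (a - i).divisors, d) *
      (coloredPartitions k i * coloredPartitions k b) =
      (∑ i ∈ range a, (∑ d ∈ (a - i).divisors, d) * coloredPartitions k i) *
      coloredPartitions k b := by
    rw [sum_mul]
    exact sum_congr rfl fun i _ => by ring
  rw [h1, h2, mul_add, ← mul_assoc k, ← mul_assoc k, ← mul_coloredPartitions,
    ← mul_coloredPartitions]
  ring

theorem coloredPartitions_add_lt_of_forall_le {k a b : ℕ} (hk : 2 ≤ k) (ha : 2 ≤ a)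
    (hb : 1 ≤ b) (hba : b ≤ a)
    (h : ∀ i < a, coloredPartitions k (b + i) ≤ coloredPartitions k i * coloredPartitions k b) :
    coloredPartitions k (a + b) < coloredPartitions k a * coloredPartitions k b := by
  refine Nat.lt_of_mul_lt_mul_left (a := a + b) ?_
  rw [add_mul_coloredPartitions_add, add_mul_coloredPartitions_mul]
  refine Nat.mul_lt_mul_of_pos_left (add_lt_add_of_lt_of_le ?_ ?_) (by omega)
  · refine sum_lt_sum_of_nonempty ⟨0, mem_range.2 hb⟩ fun i hi => ?_
    have hi := mem_range.1 hi
    refine Nat.mul_lt_mul_of_pos_right ?_ (coloredPartitions_pos (by omega) i)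
    exact (sum_divisors_add_lt ha (by omega) (by omega)).trans_le
      (Nat.mul_le_mul_left _ (coloredPartitions_mono hk a))
  · exact sum_le_sum fun i hi => Nat.mul_le_mul_left _ (h i (mem_range.1 hi))

theorem sum_divisors_add_sum_divisors_lt {a : ℕ} (ha : 4 ≤ a) :
    (∑ d ∈ (a + 1).divisors, d) + ∑ d ∈ (a - 1).divisors, d < coloredPartitions 2 a := by
  rcases ha.eq_or_lt with rfl | h
  · rw [coloredPartitions_two_values.2.2.1]
    decide
  · have h1 := lt_two_mul_coloredPartitions_two h
    have h2 := two_mul_sum_divisors_le (a + 1)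
    have h3 := two_mul_sum_divisors_le (a - 1)
    rw [Nat.sub_add_cancel (by omega)] at h3
    zify [show 1 ≤ a by omega] at *
    nlinarith

theorem coloredPartitions_two_succ_lt {a : ℕ} (ha : 4 ≤ a)
    (h : ∀ i < a, i ≠ 1 → coloredPartitions 2 (1 + i) ≤ coloredPartitions 2 i * 2) :
    coloredPartitions 2 (a + 1) < coloredPartitions 2 a * coloredPartitions 2 1 := by
  refine Nat.lt_of_mul_lt_mul_left (a := a + 1) ?_
  rw [add_mul_coloredPartitions_add, add_mul_coloredPartitions_mul]
  refine Nat.mul_lt_mul_of_pos_left ?_ (by omega)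
  have hle : ∑ i ∈ range a, (∑ d ∈ (a - i).divisors, d) * coloredPartitions 2 (1 + i) ≤
      ∑ i ∈ range a, ((∑ d ∈ (a - i).divisors, d) * (coloredPartitions 2 i * 2) +
        if i = 1 then ∑ d ∈ (a - 1).divisors, d else 0) := by
    refine sum_le_sum fun i hi => ?_
    split_ifs with h1
    · rw [h1, coloredPartitions_one, coloredPartitions_two_values.1]
      omega
    · exact Nat.mul_le_mul_left _ (h i (mem_range.1 hi) h1)
  rw [sum_add_distrib, sum_ite_eq', if_pos (mem_range.2 (by omega))] at hle
  have hlt := sum_divisors_add_sum_divisors_lt ha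
  simp only [sum_range_one, coloredPartitions_zero, coloredPartitions_one, Nat.sub_zero,
    Nat.divisors_one, sum_singleton, mul_one, one_mul]
  omega

theorem colored_partition_inequality (k a b : ℕ) (hk : 2 ≤ k) (hb : 1 ≤ b) (hba : b ≤ a)
    (h1 : (a, b, k) ≠ (1, 1, 2)) (h2 : (a, b, k) ≠ (2, 1, 2))
    (h3 : (a, b, k) ≠ (3, 1, 2)) (h4 : (a, b, k) ≠ (1, 1, 3)) :
    coloredPartitions k a * coloredPartitions k b > coloredPartitions k (a + b) := by
  induction hn : a + b using Nat.strong_induction_on generalizing a b with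
  | _ n ih =>
  subst hn
  have weak_of_le : ∀ i j, i + j < a + b → 1 ≤ j → j ≤ i → ¬(k = 2 ∧ i = 1) →
      coloredPartitions k (i + j) ≤ coloredPartitions k i * coloredPartitions k j := by
    intro i j hlt hj hji hne
    obtain ⟨v2, v3, v4, -⟩ := coloredPartitions_two_values
    by_cases e2 : (i, j, k) = (2, 1, 2)
    · simp only [Prod.mk.injEq] at e2
      obtain ⟨rfl, rfl, rfl⟩ := e2
      simp [v2, v3, coloredPartitions_one]
    by_cases e3 : (i, j, k) = (3, 1, 2)
    · simp only [Prod.mk.injEq] at e3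
      obtain ⟨rfl, rfl, rfl⟩ := e3
      simp [v3, v4, coloredPartitions_one]
    by_cases e4 : (i, j, k) = (1, 1, 3)
    · simp only [Prod.mk.injEq] at e4
      obtain ⟨rfl, rfl, rfl⟩ := e4
      have := two_mul_coloredPartitions_two 3
      simp only [coloredPartitions_one, Nat.reduceAdd]
      omega
    exact (ih _ hlt i j hj hji (fun h => hne (by simp_all)) e2 e3 e4 rfl).le
  have weak : ∀ i < a, ¬(k = 2 ∧ b = 1 ∧ i = 1) →
      coloredPartitions k (b + i) ≤ coloredPartitions k i * coloredPartitions k b := by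
    intro i hi hne
    rcases Nat.eq_zero_or_pos i with rfl | hi0
    · simp [coloredPartitions_zero]
    rcases le_total b i with hbi | hib
    · rw [add_comm b i]
      exact weak_of_le i b (by omega) hb hbi (by omega)
    · rw [mul_comm]
      exact weak_of_le b i (by omega) hi0 hib (by omega)
  rcases hba.eq_or_lt with rfl | hlt
  · rcases hb.eq_or_lt with rfl | hb2
    · have := two_mul_coloredPartitions_two k
      have hk4 : 4 ≤ k := by
        simp only [ne_eq, Prod.mk.injEq, true_and] at h1 h4
        omega
      rw [coloredPartitions_one]
      nlinarith
    · exact coloredPartitions_add_lt_of_forall_le hk hb2 hb le_rfl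
        fun i hi => weak i hi (by omega)
  · by_cases hk2 : k = 2 ∧ b = 1
    · obtain ⟨rfl, rfl⟩ := hk2
      have ha : 4 ≤ a := by
        simp only [ne_eq, Prod.mk.injEq, and_true] at h2 h3
        omega
      refine coloredPartitions_two_succ_lt ha fun i hi hi1 => ?_
      have := weak i hi (by omega)
      rwa [coloredPartitions_one] at this
    · exact coloredPartitions_add_lt_of_forall_le hk (by omega) hb hba
        fun i hi => weak i hi (by omega)
end

section
/- For every integer n ≥ 2, the partition function satisfies p(n − 1) + p(n − 2) ≥ p(n). -/
/-- Add a part equal to `1` to a partition. -/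
def Nat.Partition.consOne {n : ℕ} (q : n.Partition) : (n + 1).Partition where
  parts := 1 ::ₘ q.parts
  parts_pos hi := by
    rcases Multiset.mem_cons.1 hi with rfl | hi
    · exact one_pos
    · exact q.parts_pos hi
  parts_sum := by rw [Multiset.sum_cons, q.parts_sum, add_comm]

/-- Merge all the parts equal to `1`, together with an extra `2`, into a single part. -/
def Nat.Partition.mergeOnes {n : ℕ} (q : n.Partition) : (n + 2).Partition where
  parts := (q.parts.count 1 + 2) ::ₘ q.parts.filter (¬ · = 1)
  parts_pos hi := by
    rcases Multiset.mem_cons.1 hi with rfl | hi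
    · positivity
    · exact q.parts_pos (Multiset.mem_of_mem_filter hi)
  parts_sum := by
    have h := congrArg Multiset.sum (Multiset.filter_add_not (· = 1) q.parts)
    rw [Multiset.sum_add, Multiset.filter_eq', Multiset.sum_replicate, q.parts_sum,
      smul_eq_mul, mul_one] at h
    rw [Multiset.sum_cons]
    omega

theorem Nat.Partition.exists_consOne_eq {n : ℕ} (p : (n + 1).Partition) (h : 1 ∈ p.parts) :
    ∃ q : n.Partition, q.consOne = p := by
  refine ⟨⟨p.parts.erase 1, fun hi => p.parts_pos (Multiset.mem_of_mem_erase hi), ?_⟩, ?_⟩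
  · have := Multiset.sum_erase h
    rw [p.parts_sum] at this
    omega
  · exact Nat.Partition.ext (Multiset.cons_erase h)

theorem Nat.Partition.exists_mergeOnes_eq {n : ℕ} (p : (n + 2).Partition) (h : 1 ∉ p.parts) :
    ∃ q : n.Partition, q.mergeOnes = p := by
  obtain ⟨m, hm⟩ : ∃ m, m ∈ p.parts := by
    refine Multiset.exists_mem_of_ne_zero fun h0 => ?_
    simpa [h0] using p.parts_sum
  have hm2 : 2 ≤ m := by
    have := p.parts_pos hm
    have : m ≠ 1 := fun h1 => h (h1 ▸ hm)
    omega
  have h1 : 1 ∉ p.parts.erase m := fun hi => h (Multiset.mem_of_mem_erase hi)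
  refine ⟨⟨Multiset.replicate (m - 2) 1 + p.parts.erase m, fun hi => ?_, ?_⟩, ?_⟩
  · rcases Multiset.mem_add.1 hi with hi | hi
    · rw [Multiset.eq_of_mem_replicate hi]
      exact one_pos
    · exact p.parts_pos (Multiset.mem_of_mem_erase hi)
  · have := Multiset.sum_erase hm
    rw [p.parts_sum] at this
    rw [Multiset.sum_add, Multiset.sum_replicate, smul_eq_mul, mul_one]
    omega
  · apply Nat.Partition.ext
    have hc : (p.parts.erase m).count 1 = 0 := Multiset.count_eq_zero_of_notMem h1
    have hr : (Multiset.replicate (m - 2) 1).filter (¬ · = 1) = 0 :=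
      Multiset.filter_eq_nil.2 fun a ha => not_not.2 (Multiset.eq_of_mem_replicate ha)
    have hf : (p.parts.erase m).filter (¬ · = 1) = p.parts.erase m :=
      Multiset.filter_eq_self.2 fun a ha h => h1 (h ▸ ha)
    simp only [mergeOnes]
    rw [Multiset.count_add, Multiset.count_replicate_self, hc, Multiset.filter_add, hr, hf,
      zero_add, add_zero, Nat.sub_add_cancel hm2, Multiset.cons_erase hm]

theorem partition_sum_two_previous (n : ℕ) (hn : 2 ≤ n) :
    Fintype.card (Nat.Partition (n - 1)) + Fintype.card (Nat.Partition (n - 2)) ≥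
      Fintype.card (Nat.Partition n) := by
  obtain ⟨k, rfl⟩ := Nat.exists_eq_add_of_le' hn
  change _ ≤ Fintype.card (Nat.Partition (k + 1)) + Fintype.card (Nat.Partition k)
  rw [← Fintype.card_sum]
  refine Fintype.card_le_of_surjective
    (Sum.elim Nat.Partition.consOne Nat.Partition.mergeOnes) fun p => ?_
  by_cases h : 1 ∈ p.parts
  · obtain ⟨q, hq⟩ := p.exists_consOne_eq h
    exact ⟨Sum.inl q, hq⟩
  · obtain ⟨q, hq⟩ := p.exists_mergeOnes_eq h
    exact ⟨Sum.inr q, hq⟩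
end

section
/- For every integer n ≥ 1, the partition function satisfies 2 · p(n − 1) ≥ p(n), with equality holding if and only if n = 2. -/
/-- Every partition of `n + 1` arises from a partition of `n` either by adding a part `1`
or by increasing the smallest part, that part being strictly smaller than all the others. -/
theorem Nat.Partition.exists_predecessor {n : ℕ} (p : Nat.Partition (n + 1)) :
    ∃ q : Bool × Nat.Partition n,
      (q.1 = true ∧ p.parts = 1 ::ₘ q.2.parts) ∨
      (q.1 = false ∧ ∃ m s, p.parts = (m + 1) ::ₘ s ∧ q.2.parts = m ::ₘ s ∧ ∀ x ∈ s, m < x) := by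
  by_cases h1 : 1 ∈ p.parts
  · obtain ⟨s, hs⟩ := Multiset.exists_cons_of_mem h1
    have hsum := p.parts_sum
    rw [hs, Multiset.sum_cons] at hsum
    exact ⟨(true, ⟨s, fun {i} hi => p.parts_pos (by simp [hs, hi]), by omega⟩), Or.inl ⟨rfl, hs⟩⟩
  · have hne : ∃ a, a ∈ p.parts := by
      apply Multiset.exists_mem_of_ne_zero
      intro h0
      have hsum := p.parts_sum
      simp [h0] at hsum
    classical
    have hmem := Nat.find_spec hne
    have hmin : ∀ x ∈ p.parts, Nat.find hne ≤ x := fun x hx => Nat.find_min' hne hx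
    generalize Nat.find hne = a at hmem hmin
    have ha : 0 < a := p.parts_pos hmem
    have ha1 : a ≠ 1 := fun h => h1 (h ▸ hmem)
    obtain ⟨m, rfl⟩ : ∃ m, a = m + 1 := ⟨a - 1, by omega⟩
    obtain ⟨s, hs⟩ := Multiset.exists_cons_of_mem hmem
    have hsum := p.parts_sum
    rw [hs, Multiset.sum_cons] at hsum
    have hlt : ∀ x ∈ s, m < x := fun x hx => hmin x (by simp [hs, hx])
    refine ⟨(false, ⟨m ::ₘ s, fun {i} hi => ?_, by rw [Multiset.sum_cons]; omega⟩),
      Or.inr ⟨rfl, m, s, hs, rfl, hlt⟩⟩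
    rcases Multiset.mem_cons.1 hi with rfl | hi
    · omega
    · exact p.parts_pos (by simp [hs, hi])

theorem Multiset.eq_of_cons_eq_cons_of_forall_lt {α : Type*} [LinearOrder α] {a b : α}
    {s t : Multiset α} (h : a ::ₘ s = b ::ₘ t) (hs : ∀ x ∈ s, a < x) (ht : ∀ x ∈ t, b < x) :
    a = b ∧ s = t := by
  rcases Multiset.cons_eq_cons.1 h with h | ⟨-, u, rfl, rfl⟩
  · exact h
  · exact absurd (hs b (by simp)) (ht a (by simp)).asymm

theorem Nat.Partition.card_succ_lt_two_mul_card {n : ℕ} (hn : 2 ≤ n) :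
    Fintype.card (Nat.Partition (n + 1)) < 2 * Fintype.card (Nat.Partition n) := by
  choose f hf using fun p : Nat.Partition (n + 1) => p.exists_predecessor
  have hinj : Function.Injective f := by
    intro p p' h
    have hp := hf p
    rw [h] at hp
    ext1
    rcases hp with ⟨h1, h2⟩ | ⟨h1, m, s, h2, h3, h4⟩ <;>
      rcases hf p' with ⟨h1', h2'⟩ | ⟨h1', m', s', h2', h3', h4'⟩
    · rw [h2, h2']
    · simp [h1] at h1'
    · simp [h1] at h1'
    · obtain ⟨rfl, rfl⟩ := Multiset.eq_of_cons_eq_cons_of_forall_lt (h3.symm.trans h3') h4 h4'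
      rw [h2, h2']
  let ones : Nat.Partition n :=
    ⟨Multiset.replicate n 1, fun {i} hi => by simp [Multiset.eq_of_mem_replicate hi], by simp⟩
  have hones : (false, ones) ∉ Set.range f := by
    rintro ⟨p, hp⟩
    rcases hf p with ⟨h, -⟩ | ⟨-, m, s, -, h, hlt⟩
    · simp [hp] at h
    · rw [hp] at h
      change Multiset.replicate n 1 = m ::ₘ s at h
      obtain ⟨k, rfl⟩ : ∃ k, n = k + 2 := ⟨n - 2, by omega⟩
      have hm : m = 1 := Multiset.eq_of_mem_replicate (h ▸ Multiset.mem_cons_self m s)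
      subst hm
      rw [Multiset.replicate_succ, Multiset.cons_inj_right] at h
      exact absurd (hlt 1 (by simp [← h])) (lt_irrefl 1)
  simpa using Fintype.card_lt_of_injective_of_notMem f hinj hones

theorem Nat.Partition.card_two : Fintype.card (Nat.Partition 2) = 2 := by
  apply le_antisymm
  · simpa [composition_card] using Fintype.card_le_of_surjective _ (Nat.Partition.ofComposition_surj (n := 2))
  · refine Fintype.one_lt_card_iff.2 ⟨⟨{2}, by simp, by simp⟩, ⟨{1, 1}, by simp, by simp⟩, ?_⟩
    intro h
    simpa using congrArg (fun p : Nat.Partition 2 => Multiset.card p.parts) h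

theorem partition_double_previous (n : ℕ) (hn : 1 ≤ n) :
    2 * Fintype.card (Nat.Partition (n - 1)) ≥ Fintype.card (Nat.Partition n) ∧
    (2 * Fintype.card (Nat.Partition (n - 1)) = Fintype.card (Nat.Partition n) ↔ n = 2) := by
  obtain rfl | rfl | h : n = 1 ∨ n = 2 ∨ 3 ≤ n := by omega
  · simp
  · simp [Nat.Partition.card_two]
  · obtain ⟨k, rfl⟩ : ∃ k, n = k + 1 := ⟨n - 1, by omega⟩
    have := Nat.Partition.card_succ_lt_two_mul_card (n := k) (by omega)
    rw [Nat.add_sub_cancel]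
    omega
end

section
/- Let k ≥ 2 and let c ≥ d ≥ 1 be positive integers with (c, d, k) ≠ (1, 1, 2). Then p_{-k}(c | no parts equal to 1 with color 1) · p_{-k}(d | no parts equal to 1 with color 2) ≥ p_{-k}(c + d | no parts equal to 1 with color 1 and no parts equal to 1 with color 2). -/
/-- The sum of the part sizes of a multiset of (size, color) pairs. -/
def partWeight (s : Multiset (ℕ × ℕ)) : ℕ := (s.map Prod.fst).sum

/-- The largest color occurring in a multiset of (size, color) pairs. -/
def maxColor (s : Multiset (ℕ × ℕ)) : ℕ := (s.map Prod.snd).sup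

/-- Parts are compared by color; within color `0` small parts come first, within every other
color large parts come first. -/
def partLE (x y : ℕ × ℕ) : Prop :=
  x.2 < y.2 ∨ x.2 = y.2 ∧ ((x.2 = 0 ∧ x.1 ≤ y.1) ∨ (x.2 ≠ 0 ∧ y.1 ≤ x.1))

/-- Reassembles a colored partition of `c + d` from a pair of colored partitions of `c` and `d`.
It is the left inverse of cutting a partition, ordered by `partLE`, at weight `c`, where a part
lying across the cut is broken into two pieces. -/
noncomputable def glue (c : ℕ) (s t : Multiset (ℕ × ℕ)) : Multiset (ℕ × ℕ) :=
  if (1, 0) ∈ t then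
    if (1, maxColor s) ∈ s then
      s.filter (· ≠ (1, maxColor s)) + t.filter (· ≠ (1, 0)) +
        {(s.count (1, maxColor s) + t.count (1, 0), maxColor s)}
    else if maxColor s = 0 then
      Multiset.replicate ((c + 1) / 2) (2, 0) + t.erase (1, 0)
    else
      s.filter (·.2 = 0) + t.erase (1, 0) + {(partWeight (s.filter (·.2 ≠ 0)) + 1, 0)}
  else if (1, 1) ∈ s then
    if 0 ∈ t.map Prod.snd then
      s.filter (· ≠ (1, 1)) + t.erase (sInf {b | (b, 0) ∈ t}, 0) +
        {(s.count (1, 1) + sInf {b | (b, 0) ∈ t}, 0)}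
    else {(2, 0)}
  else s + t

@[simp] lemma partWeight_zero : partWeight 0 = 0 := rfl

@[simp] lemma partWeight_add (s t : Multiset (ℕ × ℕ)) :
    partWeight (s + t) = partWeight s + partWeight t := by simp [partWeight]

@[simp] lemma partWeight_singleton (p : ℕ × ℕ) : partWeight {p} = p.1 := by simp [partWeight]

@[simp] lemma partWeight_replicate (n : ℕ) (p : ℕ × ℕ) :
    partWeight (Multiset.replicate n p) = n * p.1 := by simp [partWeight]

lemma maxColor_eq {s : Multiset (ℕ × ℕ)} {j : ℕ} (hle : ∀ x ∈ s, x.2 ≤ j)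
    (hmem : ∃ x ∈ s, x.2 = j) : maxColor s = j := by
  apply le_antisymm
  · refine Multiset.sup_le.2 fun b hb => ?_
    obtain ⟨x, hx, rfl⟩ := Multiset.mem_map.1 hb
    exact hle x hx
  · obtain ⟨x, hx, rfl⟩ := hmem
    exact Multiset.le_sup (Multiset.mem_map_of_mem _ hx)

lemma filter_ne_add_replicate {s : Multiset (ℕ × ℕ)} {p : ℕ × ℕ} (hp : p ∉ s) (n : ℕ) :
    (s + Multiset.replicate n p).filter (· ≠ p) = s := by
  have h1 : s.filter (· ≠ p) = s :=
    Multiset.filter_eq_self.2 fun x hx h => hp (h ▸ hx)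
  have h2 : (Multiset.replicate n p).filter (· ≠ p) = 0 :=
    Multiset.filter_eq_nil.2 fun x hx h => h (Multiset.eq_of_mem_replicate hx)
  rw [Multiset.filter_add, h1, h2, add_zero]

lemma count_add_replicate {s : Multiset (ℕ × ℕ)} {p : ℕ × ℕ} (hp : p ∉ s) (n : ℕ) :
    (s + Multiset.replicate n p).count p = n := by
  simp [Multiset.count_eq_zero_of_notMem hp]

lemma erase_add_singleton (s : Multiset (ℕ × ℕ)) (p : ℕ × ℕ) : (s + {p}).erase p = s := by
  rw [add_comm, Multiset.singleton_add, Multiset.erase_cons_head]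

lemma glue_of_notMem {c : ℕ} {s t : Multiset (ℕ × ℕ)} (hs : (1, 1) ∉ s) (ht : (1, 0) ∉ t) :
    glue c s t = s + t := by
  rw [glue, if_neg ht, if_neg hs]

lemma glue_replicate_replicate {c a b j : ℕ} {s t : Multiset (ℕ × ℕ)} (ha : 0 < a) (hb : 0 < b)
    (hle : ∀ x ∈ s, x.2 ≤ j) (hs : (1, j) ∉ s) (ht : (1, 0) ∉ t) :
    glue c (s + Multiset.replicate a (1, j)) (t + Multiset.replicate b (1, 0)) =
      s + t + {(a + b, j)} := by
  have hj : (1, j) ∈ s + Multiset.replicate a (1, j) := by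
    simp [Multiset.mem_replicate, ha.ne']
  have hmax : maxColor (s + Multiset.replicate a (1, j)) = j := by
    refine maxColor_eq (fun x hx => ?_) ⟨_, hj, rfl⟩
    rcases Multiset.mem_add.1 hx with h | h
    · exact hle x h
    · rw [Multiset.eq_of_mem_replicate h]
  rw [glue, if_pos (by simp [Multiset.mem_replicate, hb.ne']), hmax, if_pos hj,
    filter_ne_add_replicate hs, filter_ne_add_replicate ht, count_add_replicate hs,
    count_add_replicate ht]

lemma glue_replicate_singleton {c a b : ℕ} {s t : Multiset (ℕ × ℕ)} (ha : 0 < a) (hb : 2 ≤ b)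
    (hs : (1, 1) ∉ s) (ht : (1, 0) ∉ t) (hmin : ∀ x ∈ t, x.2 = 0 → b ≤ x.1) :
    glue c (s + Multiset.replicate a (1, 1)) (t + {(b, 0)}) = s + t + {(a + b, 0)} := by
  have hinf : sInf {x | (x, 0) ∈ t + {(b, 0)}} = b := by
    apply le_antisymm
    · exact Nat.sInf_le (by simp)
    · refine le_csInf ⟨b, by simp⟩ fun x hx => ?_
      rcases Multiset.mem_add.1 hx with h | h
      · exact hmin _ h rfl
      · simp at h
        omega
  rw [glue, if_neg (by simp [ht]; omega), if_pos (by simp [Multiset.mem_replicate, ha.ne']),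
    if_pos (Multiset.mem_map.2 ⟨(b, 0), by simp, rfl⟩), hinf, filter_ne_add_replicate hs,
    count_add_replicate hs, erase_add_singleton]

lemma glue_singleton_singleton {c a : ℕ} {s t : Multiset (ℕ × ℕ)} (ha : 2 ≤ a)
    (hs : ∀ x ∈ s, x.2 = 0) :
    glue c (s + {(a, 1)}) (t + {(1, 0)}) = s + t + {(a + 1, 0)} := by
  have hmax : maxColor (s + {(a, 1)}) = 1 := by
    refine maxColor_eq (fun x hx => ?_) ⟨(a, 1), by simp, rfl⟩
    rcases Multiset.mem_add.1 hx with h | h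
    · simp [hs x h]
    · rw [Multiset.mem_singleton.1 h]
  have hnot : (1, 1) ∉ s + {(a, 1)} := by
    intro h
    rcases Multiset.mem_add.1 h with h | h
    · simpa using hs _ h
    · simp at h
      omega
  have hzero : (s + {(a, 1)}).filter (·.2 = 0) = s := by
    rw [Multiset.filter_add, Multiset.filter_eq_self.2 hs, Multiset.filter_singleton]
    simp
  have hone : (s + {(a, 1)}).filter (·.2 ≠ 0) = {(a, 1)} := by
    rw [Multiset.filter_add, Multiset.filter_eq_nil.2 (fun x hx h => h (hs x hx)),
      Multiset.filter_singleton]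
    simp
  rw [glue, if_pos (by simp), hmax, if_neg hnot, if_neg one_ne_zero, hzero, hone,
    erase_add_singleton, partWeight_singleton]

lemma glue_of_color_eq_zero {c : ℕ} {s t : Multiset (ℕ × ℕ)} (hs : ∀ x ∈ s, x.2 = 0)
    (hs1 : (1, 0) ∉ s) :
    glue c s (t + {(1, 0)}) = Multiset.replicate ((c + 1) / 2) (2, 0) + t := by
  have hmax : maxColor s = 0 := by
    refine Nat.le_zero.1 (Multiset.sup_le.2 fun b hb => ?_)
    obtain ⟨x, hx, rfl⟩ := Multiset.mem_map.1 hb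
    exact (hs x hx).le
  rw [glue, if_pos (by simp), hmax, if_neg hs1, if_pos rfl, erase_add_singleton]

lemma glue_one_one_one_two (c : ℕ) : glue c {(1, 1)} {(1, 2)} = {(2, 0)} := by
  simp [glue]

/-- A sorted list of parts of weight at least `c` either splits at weight `c`, or has a part
across the cut. -/
lemma exists_cut_list {r : ℕ × ℕ → ℕ × ℕ → Prop} (l : List (ℕ × ℕ)) (hl : l.Pairwise r) (c : ℕ)
    (hc : c ≤ (l.map Prod.fst).sum) :
    (∃ s t, l = s ++ t ∧ (s.map Prod.fst).sum = c) ∨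
    ∃ s p t a b, l = s ++ p :: t ∧ p.1 = a + b ∧ 0 < a ∧ 0 < b ∧
      (s.map Prod.fst).sum + a = c ∧ (∀ x ∈ s, r x p) ∧ ∀ y ∈ t, r p y := by
  induction l generalizing c with
  | nil => exact Or.inl ⟨[], [], rfl, by simpa using hc.antisymm (by simp) |>.symm⟩
  | cons q l ih =>
    rw [List.pairwise_cons] at hl
    rw [List.map_cons, List.sum_cons] at hc
    rcases Nat.eq_zero_or_pos c with rfl | hc0
    · exact Or.inl ⟨[], q :: l, rfl, rfl⟩
    rcases lt_or_ge c q.1 with h | h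
    · exact Or.inr ⟨[], q, l, c, q.1 - c, rfl, by omega, hc0, by omega, by simp, by simp, hl.1⟩
    · rcases ih hl.2 (c - q.1) (by omega) with ⟨s, t, rfl, hs⟩ |
        ⟨s, p, t, a, b, rfl, hp, ha, hb, hs, hsp, hpt⟩
      · exact Or.inl ⟨q :: s, t, rfl, by simp [hs]; omega⟩
      · refine Or.inr ⟨q :: s, p, t, a, b, rfl, hp, ha, hb, by simp; omega, ?_, hpt⟩
        intro x hx
        rcases List.mem_cons.1 hx with rfl | hx
        · exact hl.1 p (by simp)
        · exact hsp x hx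

lemma partLE_total (x y : ℕ × ℕ) : partLE x y ∨ partLE y x := by
  unfold partLE
  omega

lemma partLE_trans (x y z : ℕ × ℕ) (hxy : partLE x y) (hyz : partLE y z) : partLE x z := by
  unfold partLE at *
  omega

lemma exists_cut (u : Multiset (ℕ × ℕ)) (c : ℕ) (hc : c ≤ partWeight u) :
    (∃ s t, u = s + t ∧ partWeight s = c) ∨
    ∃ s p t a b, u = s + t + {p} ∧ p.1 = a + b ∧ 0 < a ∧ 0 < b ∧
      partWeight s + a = c ∧ (∀ x ∈ s, partLE x p) ∧ ∀ y ∈ t, partLE p y := by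
  classical
  have : Std.Total partLE := ⟨partLE_total⟩
  have : IsTrans (ℕ × ℕ) partLE := ⟨partLE_trans⟩
  induction u using Quotient.inductionOn with | _ l => ?_
  have hperm := List.perm_insertionSort partLE l
  have hu : (l : Multiset (ℕ × ℕ)) = (l.insertionSort partLE : Multiset (ℕ × ℕ)) :=
    (Multiset.coe_eq_coe.2 hperm).symm
  rw [Multiset.quot_mk_to_coe, hu] at hc ⊢
  rcases exists_cut_list _ (List.pairwise_insertionSort partLE l) c
    (by simpa [partWeight] using hc) with ⟨s, t, h, hs⟩ |
      ⟨s, p, t, a, b, h, hp, ha, hb, hs, hsp, hpt⟩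
  · exact Or.inl ⟨s, t, by rw [h, Multiset.coe_add], by simpa [partWeight] using hs⟩
  · refine Or.inr ⟨s, p, t, a, b, ?_, hp, ha, hb, by simpa [partWeight] using hs,
      by simpa using hsp, by simpa using hpt⟩
    rw [h, add_assoc, add_comm (t : Multiset (ℕ × ℕ)), Multiset.singleton_add, Multiset.cons_coe,
      Multiset.coe_add]

/-- `IsColored k s` says that every part of `s` has positive size and color below `k`. -/
def IsColored (k : ℕ) (s : Multiset (ℕ × ℕ)) : Prop := ∀ p ∈ s, 0 < p.1 ∧ p.2 < k

lemma isColored_add {k : ℕ} {s t : Multiset (ℕ × ℕ)} :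
    IsColored k (s + t) ↔ IsColored k s ∧ IsColored k t := by
  simp only [IsColored, Multiset.mem_add, or_imp, forall_and]
  tauto

lemma isColored_singleton {k : ℕ} {p : ℕ × ℕ} : IsColored k {p} ↔ 0 < p.1 ∧ p.2 < k := by
  simp [IsColored]

lemma isColored_replicate {k n : ℕ} {p : ℕ × ℕ} (h : 0 < p.1 ∧ p.2 < k) :
    IsColored k (Multiset.replicate n p) := by
  intro x hx
  rwa [Multiset.eq_of_mem_replicate hx]

lemma eq_replicate_two {s : Multiset (ℕ × ℕ)} {k : ℕ} (hk : IsColored k s)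
    (hs : ∀ x ∈ s, partLE x (2, 0)) (hs1 : (1, 0) ∉ s) :
    s = Multiset.replicate (s.card) (2, 0) := by
  refine Multiset.eq_replicate.2 ⟨rfl, fun x hx => ?_⟩
  obtain ⟨m, j⟩ := x
  have h1 := hs _ hx
  have h2 := (hk _ hx).1
  simp only [partLE] at h1 h2
  have hj : j = 0 := by omega
  subst hj
  have : m ≠ 1 := fun h => hs1 (h ▸ hx)
  rw [show m = 2 by omega]

lemma exists_glue_eq {k c d : ℕ} (hk : 2 ≤ k) (hd : 1 ≤ d) (hdc : d ≤ c)
    (hex : (c, d, k) ≠ (1, 1, 2)) {u : Multiset (ℕ × ℕ)} (hu : IsColored k u)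
    (hw : partWeight u = c + d) (h0 : (1, 0) ∉ u) (h1 : (1, 1) ∉ u) :
    ∃ s t, IsColored k s ∧ IsColored k t ∧ partWeight s = c ∧ partWeight t = d ∧
      (1, 0) ∉ s ∧ (1, 1) ∉ t ∧ glue c s t = u := by
  rcases exists_cut u c (by omega) with ⟨s, t, rfl, hs⟩ |
    ⟨s, ⟨m, j⟩, t, a, b, rfl, hm, ha, hb, hs, hsp, hpt⟩
  · simp only [Multiset.mem_add, not_or] at h0 h1
    rw [isColored_add] at hu
    rw [partWeight_add] at hw
    exact ⟨s, t, hu.1, hu.2, hs, by omega, h0.1, h1.2, glue_of_notMem h1.1 h0.2⟩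
  obtain rfl : m = a + b := hm
  simp only [Multiset.mem_add, not_or] at h0 h1
  obtain ⟨⟨h0s, h0t⟩, -⟩ := h0
  obtain ⟨⟨h1s, h1t⟩, -⟩ := h1
  rw [isColored_add, isColored_add, isColored_singleton] at hu
  obtain ⟨⟨hus, hut⟩, -, hjk⟩ := hu
  simp only [partWeight_add, partWeight_singleton] at hw
  rcases Nat.eq_zero_or_pos j with rfl | hj
  · have hs0 : ∀ x ∈ s, x.2 = 0 := fun x hx => by
      have := hsp x hx
      simp only [partLE] at this
      omega
    rcases (show 2 ≤ b ∨ b = 1 by omega) with hb2 | rfl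
    · refine ⟨s + Multiset.replicate a (1, 1), t + {(b, 0)},
        isColored_add.2 ⟨hus, isColored_replicate ⟨one_pos, hk⟩⟩,
        isColored_add.2 ⟨hut, isColored_singleton.2 ⟨hb, hjk⟩⟩, by simp [hs], by simp; omega,
        by simp [h0s, Multiset.mem_replicate], by simp [h1t],
        glue_replicate_singleton ha hb2 h1s h0t fun x hx hx0 => ?_⟩
      have := hpt x hx
      simp only [partLE] at this
      omega
    rcases (show 2 ≤ a ∨ a = 1 by omega) with ha2 | rfl
    · exact ⟨s + {(a, 1)}, t + {(1, 0)},
        isColored_add.2 ⟨hus, isColored_singleton.2 ⟨ha, hk⟩⟩,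
        isColored_add.2 ⟨hut, isColored_singleton.2 ⟨hb, hjk⟩⟩, by simp [hs], by simp; omega,
        by simp [h0s], by simp [h1t], glue_singleton_singleton ha2 hs0⟩
    have hrep := eq_replicate_two hus hsp h0s
    generalize s.card = n at hrep
    subst hrep
    rw [partWeight_replicate] at hs
    simp only at hs
    rcases n with - | n
    · obtain rfl : c = 1 := by omega
      obtain rfl : d = 1 := by omega
      have hk3 : 2 < k := lt_of_le_of_ne hk fun h => hex (by rw [← h])
      have ht0 : t = 0 := by
        by_contra hne
        obtain ⟨x, hx⟩ := Multiset.exists_mem_of_ne_zero hne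
        have hle : x.1 ≤ partWeight t :=
          Multiset.single_le_sum (by simp) _ (Multiset.mem_map_of_mem _ hx)
        have := (hut x hx).1
        simp at hw
        omega
      subst ht0
      exact ⟨{(1, 1)}, {(1, 2)}, isColored_singleton.2 ⟨one_pos, hk⟩,
        isColored_singleton.2 ⟨one_pos, hk3⟩, by simp, by simp, by simp, by simp,
        by rw [glue_one_one_one_two]; simp⟩
    · refine ⟨Multiset.replicate n (2, 0) + {(3, 0)}, t + {(1, 0)},
        isColored_add.2 ⟨isColored_replicate ⟨two_pos, hjk⟩,
          isColored_singleton.2 ⟨three_pos, hjk⟩⟩,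
        isColored_add.2 ⟨hut, isColored_singleton.2 ⟨one_pos, hjk⟩⟩, by simp; omega,
        by rw [partWeight_replicate] at hw; simp at hw ⊢; omega,
        by simp [Multiset.mem_replicate], by simp [h1t], ?_⟩
      rw [glue_of_color_eq_zero, show (c + 1) / 2 = n + 1 + 1 by omega,
        Multiset.replicate_add (n + 1) 1, Multiset.replicate_one, add_right_comm]
      · intro x hx
        rcases Multiset.mem_add.1 hx with h | h
        · rw [Multiset.eq_of_mem_replicate h]
        · rw [Multiset.mem_singleton.1 h]
      · simp [Multiset.mem_replicate]
  · refine ⟨s + Multiset.replicate a (1, j), t + Multiset.replicate b (1, 0),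
      isColored_add.2 ⟨hus, isColored_replicate ⟨one_pos, hjk⟩⟩,
      isColored_add.2 ⟨hut, isColored_replicate ⟨one_pos, by omega⟩⟩, by simp [hs],
      by simp; omega, by simp [h0s, Multiset.mem_replicate]; omega,
      by simp [h1t, Multiset.mem_replicate], glue_replicate_replicate ha hb ?_ ?_ h0t⟩
    · intro x hx
      have := hsp x hx
      simp only [partLE] at this
      omega
    · intro hx
      have := hsp _ hx
      simp only [partLE] at this
      omega

lemma ColoredPartition.parts_injective {k n : ℕ} :
    Function.Injective (ColoredPartition.parts : ColoredPartition k n → Multiset (ℕ × ℕ)) := by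
  rintro ⟨s, _, _, _⟩ ⟨t, _, _, _⟩ h
  cases h
  rfl

instance (k n : ℕ) : Finite (ColoredPartition k n) := by
  have hfin : (Set.Iic (n • (Finset.range (n + 1) ×ˢ Finset.range k).val)).Finite :=
    Set.finite_Iic _
  have := hfin.to_subtype
  refine Finite.of_injective (β := Set.Iic (n • (Finset.range (n + 1) ×ˢ Finset.range k).val))
    (fun p => ⟨p.parts, ?_⟩) fun p q h => ColoredPartition.parts_injective (congrArg Subtype.val h)
  refine Multiset.le_iff_count.2 fun x => ?_
  by_cases hx : x ∈ p.parts
  · have hle : x.1 ≤ n := by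
      rw [← p.parts_sum]
      exact Multiset.single_le_sum (by simp) _ (Multiset.mem_map_of_mem _ hx)
    have hmem : x ∈ (Finset.range (n + 1) ×ˢ Finset.range k).val := by
      rw [Finset.mem_val, Finset.mem_product, Finset.mem_range, Finset.mem_range]
      exact ⟨by omega, p.parts_color x hx⟩
    have hcard : p.parts.card ≤ n := by
      have := Multiset.card_nsmul_le_sum (s := p.parts.map Prod.fst) (a := 1) fun m hm => by
        obtain ⟨y, hy, rfl⟩ := Multiset.mem_map.1 hm
        exact p.parts_pos y hy
      simpa [p.parts_sum] using this
    rw [Multiset.count_nsmul, Multiset.count_eq_one_of_mem (Finset.nodup _) hmem]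
    have := Multiset.count_le_card x p.parts
    omega
  · simp [Multiset.count_eq_zero_of_notMem hx]

theorem key_lemma (k c d : ℕ) (hk : 2 ≤ k) (hd : 1 ≤ d) (hdc : d ≤ c)
    (hex : (c, d, k) ≠ (1, 1, 2)) :
    coloredPartitionsAvoiding k c {(1, 0)} * coloredPartitionsAvoiding k d {(1, 1)} ≥
      coloredPartitionsAvoiding k (c + d) {(1, 0), (1, 1)} := by
  unfold coloredPartitionsAvoiding
  rw [ge_iff_le, ← Nat.card_prod]
  have hcut : ∀ u : {p : ColoredPartition k (c + d) //
      ∀ x ∈ ({(1, 0), (1, 1)} : Set (ℕ × ℕ)), x ∉ p.parts},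
      ∃ q : {p : ColoredPartition k c // ∀ x ∈ ({(1, 0)} : Set (ℕ × ℕ)), x ∉ p.parts} ×
        {p : ColoredPartition k d // ∀ x ∈ ({(1, 1)} : Set (ℕ × ℕ)), x ∉ p.parts},
      glue c q.1.1.parts q.2.1.parts = u.1.parts := by
    rintro ⟨u, hu⟩
    obtain ⟨s, t, hs, ht, hsw, htw, hs0, ht1, h⟩ := exists_glue_eq hk hd hdc hex
      (fun p hp => ⟨u.parts_pos p hp, u.parts_color p hp⟩) u.parts_sum
      (hu _ (by simp)) (hu _ (by simp))
    exact ⟨⟨⟨⟨s, fun p hp => (hs p hp).1, fun p hp => (hs p hp).2, hsw⟩, by simpa using hs0⟩,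
      ⟨⟨t, fun p hp => (ht p hp).1, fun p hp => (ht p hp).2, htw⟩, by simpa using ht1⟩⟩, h⟩
  choose f hf using hcut
  refine Nat.card_le_card_of_injective f fun u v huv => ?_
  apply Subtype.ext
  apply ColoredPartition.parts_injective
  rw [← hf u, ← hf v, huv]
end

section
/- For every integer k ≥ 2, p_{-k}(2 | no parts equal to 1 with color 1) · p_{-k}(2) − p_{-k}(4 | no parts equal to 1 with color 1) = 5 · C(k + 2, 4), where C(k + 2, 4) is the binomial coefficient; in particular this difference is positive for all k ≥ 2. -/
section WeightedMultisets

variable {α : Type*} (w : α → ℕ)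

/-- The multisets with elements in `S` and total weight `n`. -/
def weightedMultisets (S : Finset α) (n : ℕ) : Set (Multiset α) :=
  {s | (∀ p ∈ s, p ∈ S) ∧ (s.map w).sum = n}

lemma weightedMultisets_empty_zero : weightedMultisets w ∅ 0 = {0} := by
  ext s
  simp only [weightedMultisets, Finset.notMem_empty, Set.mem_ofPred_eq, Set.mem_singleton_iff]
  refine ⟨fun h => Multiset.eq_zero_of_forall_notMem h.1, ?_⟩
  rintro rfl
  simp

lemma weightedMultisets_empty_of_ne {n : ℕ} (hn : n ≠ 0) : weightedMultisets w ∅ n = ∅ := by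
  ext s
  simp only [weightedMultisets, Finset.notMem_empty, Set.mem_ofPred_eq, Set.mem_empty_iff_false,
    iff_false]
  rintro ⟨h, hs⟩
  rw [Multiset.eq_zero_of_forall_notMem h] at hs
  exact hn (by simpa using hs.symm)

variable [DecidableEq α]

lemma weightedMultisets_insert_of_lt {S : Finset α} {x : α} {n : ℕ} (h : n < w x) :
    weightedMultisets w (insert x S) n = weightedMultisets w S n := by
  ext s
  refine ⟨fun ⟨hs, hn⟩ => ⟨fun p hp => ?_, hn⟩,
    fun ⟨hs, hn⟩ => ⟨fun p hp => Finset.mem_insert_of_mem (hs p hp), hn⟩⟩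
  rcases Finset.mem_insert.1 (hs p hp) with rfl | h'
  · have := Multiset.le_sum_of_mem (Multiset.mem_map_of_mem w hp)
    omega
  · exact h'

lemma weightedMultisets_insert_add {S : Finset α} {x : α} (n : ℕ) :
    weightedMultisets w (insert x S) (n + w x) =
      weightedMultisets w S (n + w x) ∪
        Multiset.cons x '' weightedMultisets w (insert x S) n := by
  ext s
  constructor
  · rintro ⟨hs, hn⟩
    by_cases hx : x ∈ s
    · right
      obtain ⟨t, rfl⟩ := Multiset.exists_cons_of_mem hx
      refine ⟨t, ⟨fun p hp => hs p (Multiset.mem_cons_of_mem hp), ?_⟩, rfl⟩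
      simp only [Multiset.map_cons, Multiset.sum_cons] at hn
      omega
    · left
      refine ⟨fun p hp => ?_, hn⟩
      rcases Finset.mem_insert.1 (hs p hp) with rfl | h'
      · exact absurd hp hx
      · exact h'
  · rintro (⟨hs, hn⟩ | ⟨t, ⟨ht, hn⟩, rfl⟩)
    · exact ⟨fun p hp => Finset.mem_insert_of_mem (hs p hp), hn⟩
    · refine ⟨fun p hp => ?_, ?_⟩
      · rcases Multiset.mem_cons.1 hp with rfl | h'
        · exact Finset.mem_insert_self _ _
        · exact ht p h'
      · simp only [Multiset.map_cons, Multiset.sum_cons]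
        omega

lemma weightedMultisets_finite {S : Finset α} (hw : ∀ x ∈ S, 0 < w x) (n : ℕ) :
    (weightedMultisets w S n).Finite := by
  induction S using Finset.induction_on generalizing n with
  | empty =>
    rcases eq_or_ne n 0 with rfl | hn
    · simp [weightedMultisets_empty_zero]
    · simp [weightedMultisets_empty_of_ne w hn]
  | insert x S _ ih =>
    have ih := ih fun y hy => hw y (Finset.mem_insert_of_mem hy)
    have hx := hw x (Finset.mem_insert_self _ _)
    induction n using Nat.strong_induction_on with
    | _ n ihn =>
      rcases lt_or_ge n (w x) with h | h
      · rw [weightedMultisets_insert_of_lt w h]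
        exact ih n
      · obtain ⟨m, rfl⟩ := Nat.exists_eq_add_of_le' h
        rw [weightedMultisets_insert_add]
        exact (ih _).union ((ihn m (by omega)).image _)

lemma ncard_weightedMultisets_insert_add {S : Finset α} {x : α} (hxS : x ∉ S)
    (hw : ∀ y ∈ insert x S, 0 < w y) (n : ℕ) :
    (weightedMultisets w (insert x S) (n + w x)).ncard =
      (weightedMultisets w S (n + w x)).ncard + (weightedMultisets w (insert x S) n).ncard := by
  rw [weightedMultisets_insert_add, Set.ncard_union_eq _
    (weightedMultisets_finite w (fun y hy => hw y (Finset.mem_insert_of_mem hy)) _)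
    ((weightedMultisets_finite w hw _).image _),
    Set.ncard_image_of_injective _ fun _ _ => (Multiset.cons_inj_right x).1]
  rw [Set.disjoint_left]
  rintro _ ⟨hs, _⟩ ⟨t, _, rfl⟩
  exact hxS (hs x (Multiset.mem_cons_self x t))

lemma ncard_weightedMultisets_union {S T : Finset α} {m : ℕ} (hm : 0 < m)
    (hS : ∀ x ∈ S, 0 < w x) (hT : ∀ x ∈ T, w x = m) (hTS : Disjoint T S) (n : ℕ) :
    (weightedMultisets w (T ∪ S) n).ncard =
      ∑ i ∈ Finset.range (n / m + 1),
        Nat.multichoose T.card i * (weightedMultisets w S (n - i * m)).ncard := by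
  induction T using Finset.induction_on generalizing n with
  | empty =>
    rw [Finset.sum_range_succ', Finset.sum_eq_zero]
    · simp
    · simp
  | insert x T hxT ih =>
    rw [Finset.disjoint_insert_left] at hTS
    have hT' : ∀ y ∈ T, w y = m := fun y hy => hT y (Finset.mem_insert_of_mem hy)
    have ih := ih hT' hTS.2
    have hx : w x = m := hT x (Finset.mem_insert_self _ _)
    have hw : ∀ y ∈ insert x (T ∪ S), 0 < w y := by
      intro y hy
      rw [← Finset.insert_union, Finset.mem_union] at hy
      rcases hy with hy | hy
      · rw [hT y hy]; exact hm
      · exact hS y hy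
    have hxU : x ∉ T ∪ S := by simp [hxT, hTS.1]
    rw [Finset.insert_union, Finset.card_insert_of_notMem hxT]
    induction n using Nat.strong_induction_on with
    | _ n ihn =>
      rcases lt_or_ge n m with h | h
      · rw [weightedMultisets_insert_of_lt w (by omega), ih]
        simp [Nat.div_eq_of_lt h]
      · obtain ⟨l, rfl⟩ := Nat.exists_eq_add_of_le' h
        have key := ncard_weightedMultisets_insert_add w hxU hw l
        rw [hx] at key
        rw [key, ih, ihn l (by omega), Nat.add_div_right _ hm,
          Finset.sum_range_succ', Finset.sum_range_succ' _ (l / m + 1), add_right_comm,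
          ← Finset.sum_add_distrib]
        congr 1
        · refine Finset.sum_congr rfl fun i _ => ?_
          have : l + m - (i + 1) * m = l - i * m := by
            rw [Nat.succ_mul]; omega
          rw [Nat.multichoose_succ_succ, this]
          ring
        · simp

end WeightedMultisets

/-- The parts of size at most `4` with `k` colors for sizes `2, 3, 4` and the color set `C` for
size `1`. -/
def smallParts (k : ℕ) (C : Finset ℕ) : Finset (ℕ × ℕ) :=
  ({1} ×ˢ C) ∪ (({2} ×ˢ Finset.range k) ∪
    (({3} ×ˢ Finset.range k) ∪ (({4} ×ˢ Finset.range k) ∪ ∅)))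

lemma mem_smallParts {k : ℕ} {C : Finset ℕ} {p : ℕ × ℕ} :
    p ∈ smallParts k C ↔
      (p.1 = 1 ∧ p.2 ∈ C) ∨ ((p.1 = 2 ∨ p.1 = 3 ∨ p.1 = 4) ∧ p.2 < k) := by
  simp only [smallParts, Finset.mem_union, Finset.mem_product, Finset.mem_singleton,
    Finset.mem_range, Finset.notMem_empty]
  tauto

lemma ncard_weightedMultisets_singleton_product_union {a : ℕ} (ha : 0 < a) (A : Finset ℕ)
    {U : Finset (ℕ × ℕ)} (hU : ∀ p ∈ U, a < p.1) (n : ℕ) :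
    (weightedMultisets Prod.fst ({a} ×ˢ A ∪ U) n).ncard =
      ∑ i ∈ Finset.range (n / a + 1),
        A.card.multichoose i * (weightedMultisets Prod.fst U (n - i * a)).ncard := by
  have hd : Disjoint ({a} ×ˢ A) U := by
    rw [Finset.disjoint_left]
    intro p hp hpU
    have := hU p hpU
    simp only [Finset.mem_product, Finset.mem_singleton] at hp
    omega
  rw [ncard_weightedMultisets_union Prod.fst ha (fun p hp => (Nat.zero_le a).trans_lt (hU p hp))
    (fun p hp => by simpa using (Finset.mem_product.1 hp).1) hd]
  simp

lemma ncard_smallParts (k : ℕ) (C : Finset ℕ) :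
    (weightedMultisets Prod.fst (smallParts k C) 2).ncard = k + C.card.multichoose 2 ∧
    (weightedMultisets Prod.fst (smallParts k C) 4).ncard =
      k + k.multichoose 2 + C.card * k + C.card.multichoose 2 * k + C.card.multichoose 4 := by
  unfold smallParts
  have h0 (n : ℕ) : (weightedMultisets (Prod.fst : ℕ × ℕ → ℕ) ∅ n).ncard =
      if n = 0 then 1 else 0 := by
    split_ifs with h
    · rw [h, weightedMultisets_empty_zero, Set.ncard_singleton]
    · rw [weightedMultisets_empty_of_ne _ h, Set.ncard_empty]
  have b4 : ∀ p ∈ ({4} ×ˢ Finset.range k ∪ ∅ : Finset (ℕ × ℕ)), 3 < p.1 := by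
    intro p hp
    simp only [Finset.union_empty, Finset.mem_product, Finset.mem_singleton] at hp
    omega
  have h4 := ncard_weightedMultisets_singleton_product_union (a := 4) (by norm_num)
    (Finset.range k) (U := ∅) (by simp)
  generalize ({4} ×ˢ Finset.range k ∪ ∅ : Finset (ℕ × ℕ)) = U₄ at *
  have b3 : ∀ p ∈ {3} ×ˢ Finset.range k ∪ U₄, 2 < p.1 := by
    intro p hp
    have := b4 p
    simp only [Finset.mem_union, Finset.mem_product, Finset.mem_singleton] at hp
    grind
  have h3 := ncard_weightedMultisets_singleton_product_union (by norm_num) (Finset.range k) b4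
  generalize {3} ×ˢ Finset.range k ∪ U₄ = U₃ at *
  have b2 : ∀ p ∈ {2} ×ˢ Finset.range k ∪ U₃, 1 < p.1 := by
    intro p hp
    have := b3 p
    simp only [Finset.mem_union, Finset.mem_product, Finset.mem_singleton] at hp
    grind
  have h2 := ncard_weightedMultisets_singleton_product_union (by norm_num) (Finset.range k) b3
  generalize {2} ×ˢ Finset.range k ∪ U₃ = U₂ at *
  have h1 := ncard_weightedMultisets_singleton_product_union (by norm_num) C b2
  simp only [Finset.card_range] at h2 h3 h4
  have u0 := h4 0
  have u1 := h4 1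
  have u2 := h4 2
  have u3 := h4 3
  have u4 := h4 4
  norm_num [Finset.sum_range_succ, h0, -Set.ncard_eq_one] at u0 u1 u2 u3 u4
  have v0 := h3 0
  have v1 := h3 1
  have v2 := h3 2
  have v3 := h3 3
  have v4 := h3 4
  norm_num [Finset.sum_range_succ, u0, u1, u2, u3, u4, -Set.ncard_eq_one] at v0 v1 v2 v3 v4
  have w0 := h2 0
  have w1 := h2 1
  have w2 := h2 2
  have w3 := h2 3
  have w4 := h2 4
  norm_num [Finset.sum_range_succ, v0, v1, v2, v3, v4, -Set.ncard_eq_one] at w0 w1 w2 w3 w4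
  rw [h1, h1]
  norm_num [Finset.sum_range_succ, w0, w1, w2, w3, w4]

lemma coloredPartitionsAvoiding_eq_ncard {k n : ℕ} (hn : n ≤ 4) {s : Set (ℕ × ℕ)}
    {C : Finset ℕ} (hC : ∀ c, c ∈ C ↔ c < k ∧ (1, c) ∉ s) (hs : ∀ p ∈ s, p.1 = 1) :
    coloredPartitionsAvoiding k n s =
      (weightedMultisets Prod.fst (smallParts k C) n).ncard := by
  rw [coloredPartitionsAvoiding, ← Nat.card_coe_set_eq]
  refine Nat.card_congr
    { toFun := fun p => ⟨p.1.parts, fun q hq => ?_, p.1.parts_sum⟩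
      invFun := fun t => ⟨⟨t.1, fun q hq => ?_, fun q hq => ?_, t.2.2⟩, fun x hx hxt => ?_⟩
      left_inv := fun _ => rfl
      right_inv := fun _ => rfl }
  · obtain ⟨p, hp⟩ := p
    have hpos := p.parts_pos q hq
    have hcol := p.parts_color q hq
    have hle := Multiset.le_sum_of_mem (Multiset.mem_map_of_mem Prod.fst hq)
    rw [p.parts_sum] at hle
    rw [mem_smallParts, hC]
    by_cases h1 : q.1 = 1
    · refine Or.inl ⟨h1, hcol, fun h => hp _ h ?_⟩
      rw [← h1]
      exact hq
    · right
      omega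
  · have := mem_smallParts.1 (t.2.1 q hq)
    omega
  · have := mem_smallParts.1 (t.2.1 q hq)
    rw [hC] at this
    tauto
  · have h1 := hs x hx
    have := mem_smallParts.1 (t.2.1 x hxt)
    rw [hC, ← h1] at this
    rcases this with ⟨_, _, h⟩ | ⟨h, _⟩
    · exact h hx
    · omega

lemma coloredPartitions_eq_avoiding_empty (k n : ℕ) :
    coloredPartitions k n = coloredPartitionsAvoiding k n ∅ :=
  Nat.card_congr (Equiv.subtypeUnivEquiv (by simp)).symm

theorem base_case_difference (k : ℕ) (hk : 2 ≤ k) :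
    coloredPartitionsAvoiding k 2 {(1, 0)} * coloredPartitions k 2 -
        coloredPartitionsAvoiding k 4 {(1, 0)} = 5 * Nat.choose (k + 2) 4 ∧
    coloredPartitionsAvoiding k 4 {(1, 0)} <
      coloredPartitionsAvoiding k 2 {(1, 0)} * coloredPartitions k 2 := by
  have hC : ∀ c, c ∈ (Finset.range k).erase 0 ↔ c < k ∧ (1, c) ∉ ({(1, 0)} : Set (ℕ × ℕ)) := by
    simp [and_comm]
  rw [coloredPartitions_eq_avoiding_empty,
    coloredPartitionsAvoiding_eq_ncard (by norm_num) hC (by simp),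
    coloredPartitionsAvoiding_eq_ncard (by norm_num) hC (by simp),
    coloredPartitionsAvoiding_eq_ncard (C := Finset.range k) (by norm_num) (by simp) (by simp),
    (ncard_smallParts _ _).1, (ncard_smallParts _ _).1, (ncard_smallParts _ _).2,
    Finset.card_erase_of_mem (by simp; omega), Finset.card_range]
  obtain ⟨j, rfl⟩ := Nat.exists_eq_add_of_le' hk
  have h1 : j + 2 - 1 = j + 1 := rfl
  have key : (j + 2 + (j + 1).multichoose 2) * (j + 2 + (j + 2).multichoose 2) =
      (j + 2 + (j + 2).multichoose 2 + (j + 1) * (j + 2) + (j + 1).multichoose 2 * (j + 2) +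
        (j + 1).multichoose 4) + 5 * (j + 2 + 2).choose 4 := by
    simp only [Nat.multichoose_eq]
    have e1 : j + 1 + 2 - 1 = j + 2 := rfl
    have e2 : j + 2 + 2 - 1 = j + 3 := rfl
    have e3 : j + 1 + 4 - 1 = j + 4 := rfl
    rw [e1, e2, e3]
    have c1 : ((j + 2).choose 2 : ℚ) = (j + 2) * (j + 1) / 2 := by
      rw [Nat.cast_choose_two]; push_cast; ring
    have c2 : ((j + 3).choose 2 : ℚ) = (j + 3) * (j + 2) / 2 := by
      rw [Nat.cast_choose_two]; push_cast; ring
    have c3 : ((j + 4).choose 4 : ℚ) = (j + 4) * (j + 3) * (j + 2) * (j + 1) / 24 := by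
      rw [Nat.cast_choose ℚ (by omega : 4 ≤ j + 4), Nat.add_sub_cancel]
      simp only [Nat.factorial_succ]
      have := Nat.factorial_ne_zero j
      field_simp
      simp
      ring
    have e4 : j + 2 + 2 = j + 4 := rfl
    rw [e4, ← Nat.cast_inj (R := ℚ)]
    push_cast
    rw [c1, c2, c3]
    ring
  have hpos : 0 < (j + 2 + 2).choose 4 := Nat.choose_pos (by omega)
  rw [h1, key]
  omega
end
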